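/- The language equivalence problem for TOPL automata is undecidable: taking V = ℕ (so that automata admit finite descriptions), the set of pairs (A₁, A₂) of TOPL automata over V^n with L(A₁) = L(A₂) is not a computable predicate on (codes of) pairs of automata; i.e. there is no algorithm that, given TOPL automata A₁ and A₂, decides whether L(A₁) = L(A₂). -/

import Mathlib

namespace Topl

/-- A (code for a) guard: a finite conjunction of literals `(b, i, j)`, where `b = true`
means `eq i j` (register `i` equals component `j` of the letter), `b = false` means
`neq i j`, and the empty conjunction is the guard `true`. -/
abbrev GuardC : Type := List (Bool × ℕ × ℕ)

/-- A (code for an) action: a finite sequence of assignments `set i := j`;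
the empty sequence is `nop`. -/
abbrev ActionC : Type := List (ℕ × ℕ)

/-- A code for a TOPL automaton over `V = ℕ`, with `m` registers, arity `n`,
states `{0, …, k−1}`, initial state `q0`, initial store `s0`,
transition list `delta` and final states `F`. -/
structure ToplC where
  m : ℕ
  n : ℕ
  k : ℕ
  q0 : ℕ
  s0 : List ℕ
  delta : List (ℕ × (GuardC × ActionC) × ℕ)
  F : List ℕ

def toplCEquiv : ToplC ≃ ℕ × ℕ × ℕ × ℕ × List ℕ × List (ℕ × (GuardC × ActionC) × ℕ) × List ℕ where
  toFun A := (A.m, A.n, A.k, A.q0, A.s0, A.delta, A.F)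
  invFun p := ⟨p.1, p.2.1, p.2.2.1, p.2.2.2.1, p.2.2.2.2.1, p.2.2.2.2.2.1, p.2.2.2.2.2.2⟩
  left_inv A := rfl
  right_inv p := rfl

instance : Primcodable ToplC := Primcodable.ofEquiv _ toplCEquiv

/-- Satisfaction of a guard by a store `s` and a letter `ℓ` (both given as lists). -/
def GuardC.Sat (s ℓ : List ℕ) (g : GuardC) : Prop :=
  ∀ p ∈ g, (p.1 = true → s.getD p.2.1 0 = ℓ.getD p.2.2 0) ∧
           (p.1 = false → s.getD p.2.1 0 ≠ ℓ.getD p.2.2 0)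

/-- The store transformation of an action on input letter `ℓ`. -/
def ActionC.run (ℓ : List ℕ) (a : ActionC) (s : List ℕ) : List ℕ :=
  a.foldl (fun s p => s.set p.1 (ℓ.getD p.2 0)) s

/-- One edge of the configuration graph. -/
def ToplC.Step (A : ToplC) (x₁ : ℕ × List ℕ) (ℓ : List ℕ) (x₂ : ℕ × List ℕ) : Prop :=
  ∃ g a, (x₁.1, (g, a), x₂.1) ∈ A.delta ∧ GuardC.Sat x₁.2 ℓ g ∧ ActionC.run ℓ a x₁.2 = x₂.2

/-- Walks in the configuration graph, labelled by words. -/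
inductive ToplC.Reach (A : ToplC) : ℕ × List ℕ → List (List ℕ) → ℕ × List ℕ → Prop
  | nil (x) : ToplC.Reach A x [] x
  | cons {x₁ x₂ x₃ ℓ w} : A.Step x₁ ℓ x₂ → ToplC.Reach A x₂ w x₃ → ToplC.Reach A x₁ (ℓ :: w) x₃

/-- The language of a coded TOPL automaton: words over the alphabet `ℕ^n`
(letters are lists of length `n`) labelling walks from the initial configuration
to a configuration whose state is final. -/
def ToplC.Lang (A : ToplC) : Set (List (List ℕ)) :=
  { w | (∀ ℓ ∈ w, ℓ.length = A.n) ∧ ∃ x, A.Reach (A.q0, A.s0) w x ∧ x.1 ∈ A.F }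

/-- Well-formedness: the code really describes a TOPL automaton with `m` registers over
`n`-tuples and `k` states. -/
def ToplC.WF (A : ToplC) : Prop :=
  A.q0 < A.k ∧ A.s0.length = A.m ∧ (∀ q ∈ A.F, q < A.k) ∧
  ∀ t ∈ A.delta, t.1 < A.k ∧ t.2.2 < A.k ∧
    (∀ p ∈ t.2.1.1, p.2.1 < A.m ∧ p.2.2 < A.n) ∧
    (∀ p ∈ t.2.1.2, p.1 < A.m ∧ p.2 < A.n)

/-- All words over the alphabet `ℕ^n`. -/
def fullLang (n : ℕ) : Set (List (List ℕ)) := { w | ∀ ℓ ∈ w, ℓ.length = n }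

/-- Acceptance of a word from a given configuration. -/
def ToplC.Acc (A : ToplC) (q : ℕ) (s : List ℕ) (w : List (List ℕ)) : Prop :=
  ∃ x, A.Reach (q, s) w x ∧ x.1 ∈ A.F

theorem ToplC.acc_nil {A : ToplC} {q : ℕ} {s : List ℕ} : A.Acc q s [] ↔ q ∈ A.F := by
  constructor
  · rintro ⟨x, h, hx⟩
    cases h
    exact hx
  · exact fun h => ⟨(q, s), .nil _, h⟩

theorem ToplC.acc_cons {A : ToplC} {q : ℕ} {s ℓ : List ℕ} {w : List (List ℕ)} :
    A.Acc q s (ℓ :: w) ↔ ∃ g a q', (q, (g, a), q') ∈ A.delta ∧ GuardC.Sat s ℓ g ∧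
      A.Acc q' (ActionC.run ℓ a s) w := by
  constructor
  · rintro ⟨x, h, hx⟩
    cases h with
    | @cons _ x₂ _ _ _ hs hr =>
      obtain ⟨g, a, hd, hg, ha⟩ := hs
      refine ⟨g, a, x₂.1, hd, hg, x, ?_, hx⟩
      rw [ha]
      exact hr
  · rintro ⟨g, a, q', hd, hg, x, hr, hx⟩
    exact ⟨x, .cons ⟨g, a, hd, hg, rfl⟩ hr, hx⟩

/-- Satisfaction of a guard when the store is given as a function. -/
def GSat (s : ℕ → ℕ) (ℓ : List ℕ) (g : GuardC) : Prop :=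
  ∀ p ∈ g, (p.1 = true → s p.2.1 = ℓ.getD p.2.2 0) ∧
           (p.1 = false → s p.2.1 ≠ ℓ.getD p.2.2 0)

/-- Register contents after storing the letter `ℓ` in the first eight registers, register
`8 + c` being reserved for the constant `c`. -/
def val (ℓ : List ℕ) (r : ℕ) : ℕ := if r < 8 then ℓ.getD r 0 else r - 8

/-- A rule `(q, g, P)`: a letter that satisfies `g` must be followed, at some later
position, by a letter agreeing with it in the sense of `P`. Rules with `q = 0` concern
the first letter of a word, those with `q = 1` all other letters. -/
abbrev Rule : Type := ℕ × GuardC × List (ℕ × ℕ)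

/-- The letter `ℓ'` has in column `p.2` the contents of register `p.1`, for all `p ∈ P`. -/
def Matches (ℓ ℓ' : List ℕ) (P : List (ℕ × ℕ)) : Prop :=
  ∀ p ∈ P, val ℓ p.1 = ℓ'.getD p.2 0

/-- The action storing the whole letter. -/
def storeAct : ActionC := (List.range 8).map fun i => (i, i)

/-- The store holding `ℓ`, followed by the constants below `M`. -/
def storeOf (M : ℕ) (ℓ : List ℕ) : List ℕ := ℓ ++ List.range M

/-- The transitions that look for a violation of the rule `r`, using the state `q`. -/
def ruleTrans (r : Rule) (q : ℕ) : List (ℕ × (GuardC × ActionC) × ℕ) :=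
  (r.1, (r.2.1, storeAct), q) :: r.2.2.map fun p => (q, ([(false, p)], []), q)

/-- Transitions of the automaton that accepts the words violating one of the rules `R`,
having a letter satisfying a guard in `S`, or a pair of letters satisfying a guard
in `H`. -/
def errDelta (S H : List GuardC) (R : List Rule) : List (ℕ × (GuardC × ActionC) × ℕ) :=
  [(0, ([], []), 1), (1, ([], []), 1), (2, ([], []), 2), (1, ([], storeAct), 3),
    (3, ([], []), 3)] ++ (S.map fun g => (1, (g, []), 2)) ++ (H.map fun g => (3, (g, []), 2)) ++
  (List.range R.length).flatMap fun i => ruleTrans (R.getD i default) (4 + i)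

/-- The automaton that accepts the erroneous words. -/
def errAut (S H : List GuardC) (R : List Rule) (M : ℕ) : ToplC where
  m := 8 + M
  n := 8
  k := 4 + R.length
  q0 := 0
  s0 := storeOf M (List.replicate 8 0)
  delta := errDelta S H R
  F := 0 :: 2 :: (List.range R.length).map fun i => 4 + i

/-- Words (without their first letter) that are free of errors. -/
def Clean (S H : List GuardC) (R : List Rule) : List (List ℕ) → Prop
  | [] => True
  | ℓ :: t => (∀ g ∈ S, ¬ GSat (val []) ℓ g) ∧ (∀ g ∈ H, ∀ ℓ' ∈ t, ¬ GSat (val ℓ) ℓ' g) ∧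
      (∀ r ∈ R, r.1 = 1 → GSat (val []) ℓ r.2.1 → ∃ ℓ' ∈ t, Matches ℓ ℓ' r.2.2) ∧
      Clean S H R t

/-- Words that are free of errors. -/
def Positive (S H : List GuardC) (R : List Rule) : List (List ℕ) → Prop
  | [] => False
  | ℓ :: t =>
      (∀ r ∈ R, r.1 = 0 → GSat (val []) ℓ r.2.1 → ∃ ℓ' ∈ t, Matches ℓ ℓ' r.2.2) ∧
      Clean S H R t

/-- All registers and columns mentioned in the guard exist. -/
def GuardOK (M : ℕ) (g : GuardC) : Prop := ∀ p ∈ g, p.2.1 < 8 + M ∧ p.2.2 < 8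

/-- All registers and columns mentioned in the rule exist. -/
def RuleOK (M : ℕ) (r : Rule) : Prop :=
  r.1 ≤ 1 ∧ GuardOK M r.2.1 ∧ ∀ p ∈ r.2.2, p.1 < 8 + M ∧ p.2 < 8

theorem mem_ruleTrans {r : Rule} {q q₁ q₂ : ℕ} {g : GuardC} {a : ActionC} :
    (q₁, (g, a), q₂) ∈ ruleTrans r q ↔
      (q₁ = r.1 ∧ g = r.2.1 ∧ a = storeAct ∧ q₂ = q) ∨
      (q₁ = q ∧ q₂ = q ∧ a = [] ∧ ∃ p ∈ r.2.2, g = [(false, p)]) := by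
  simp only [ruleTrans, List.mem_cons, List.mem_map, Prod.mk.injEq]
  constructor
  · rintro (⟨h1, ⟨h2, h3⟩, h4⟩ | ⟨p, hp, h1, ⟨h2, h3⟩, h4⟩)
    · exact .inl ⟨h1, h2, h3, h4⟩
    · exact .inr ⟨h1.symm, h4.symm, h3.symm, p, hp, h2.symm⟩
  · rintro (⟨h1, h2, h3, h4⟩ | ⟨h1, h2, h3, p, hp, h4⟩)
    · exact .inl ⟨h1, ⟨h2, h3⟩, h4⟩
    · exact .inr ⟨p, hp, h1.symm, ⟨h4.symm, h3.symm⟩, h2.symm⟩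

theorem mem_errDelta {S H : List GuardC} {R : List Rule} {q₁ q₂ : ℕ} {g : GuardC}
    {a : ActionC} : (q₁, (g, a), q₂) ∈ errDelta S H R ↔
      (q₁ = 0 ∧ g = [] ∧ a = [] ∧ q₂ = 1) ∨ (q₁ = 1 ∧ g = [] ∧ a = [] ∧ q₂ = 1) ∨
      (q₁ = 2 ∧ g = [] ∧ a = [] ∧ q₂ = 2) ∨ (q₁ = 1 ∧ g = [] ∧ a = storeAct ∧ q₂ = 3) ∨
      (q₁ = 3 ∧ g = [] ∧ a = [] ∧ q₂ = 3) ∨ (q₁ = 1 ∧ g ∈ S ∧ a = [] ∧ q₂ = 2) ∨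
      (q₁ = 3 ∧ g ∈ H ∧ a = [] ∧ q₂ = 2) ∨
      ∃ i, ∃ r, R[i]? = some r ∧
        ((q₁ = r.1 ∧ g = r.2.1 ∧ a = storeAct ∧ q₂ = 4 + i) ∨
        (q₁ = 4 + i ∧ q₂ = 4 + i ∧ a = [] ∧ ∃ p ∈ r.2.2, g = [(false, p)])) := by
  have key : (∃ i < R.length, (q₁, (g, a), q₂) ∈ ruleTrans (R.getD i default) (4 + i)) ↔
      ∃ i, ∃ r, R[i]? = some r ∧ (q₁, (g, a), q₂) ∈ ruleTrans r (4 + i) := by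
    constructor
    · rintro ⟨i, hi, h⟩
      refine ⟨i, R[i], by simp [hi], ?_⟩
      simpa [List.getD, hi] using h
    · rintro ⟨i, r, hi, h⟩
      have hl : i < R.length := by
        by_contra hc
        rw [List.getElem?_eq_none (by omega)] at hi
        cases hi
      exact ⟨i, hl, by simpa [List.getD, hi] using h⟩
  simp only [← mem_ruleTrans, ← key]
  simp only [errDelta, List.mem_append, List.mem_cons, List.mem_map, List.mem_flatMap,
    List.mem_range, Prod.mk.injEq, List.not_mem_nil, or_false]
  constructor
  · rintro ((((⟨h1, ⟨h2, h3⟩, h4⟩ | ⟨h1, ⟨h2, h3⟩, h4⟩ | ⟨h1, ⟨h2, h3⟩, h4⟩ | ⟨h1, ⟨h2, h3⟩, h4⟩ |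
      ⟨h1, ⟨h2, h3⟩, h4⟩) | ⟨g', hg, h1, ⟨rfl, h3⟩, h4⟩) | ⟨g', hg, h1, ⟨rfl, h3⟩, h4⟩) | h)
    · exact .inl ⟨h1, h2, h3, h4⟩
    · exact .inr (.inl ⟨h1, h2, h3, h4⟩)
    · exact .inr (.inr (.inl ⟨h1, h2, h3, h4⟩))
    · exact .inr (.inr (.inr (.inl ⟨h1, h2, h3, h4⟩)))
    · exact .inr (.inr (.inr (.inr (.inl ⟨h1, h2, h3, h4⟩))))
    · exact .inr (.inr (.inr (.inr (.inr (.inl ⟨h1.symm, hg, h3.symm, h4.symm⟩)))))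
    · exact .inr (.inr (.inr (.inr (.inr (.inr (.inl ⟨h1.symm, hg, h3.symm, h4.symm⟩))))))
    · exact .inr (.inr (.inr (.inr (.inr (.inr (.inr h))))))
  · rintro (⟨h1, h2, h3, h4⟩ | ⟨h1, h2, h3, h4⟩ | ⟨h1, h2, h3, h4⟩ | ⟨h1, h2, h3, h4⟩ |
      ⟨h1, h2, h3, h4⟩ | ⟨h1, hg, h3, h4⟩ | ⟨h1, hg, h3, h4⟩ | h)
    · exact .inl (.inl (.inl (.inl ⟨h1, ⟨h2, h3⟩, h4⟩)))
    · exact .inl (.inl (.inl (.inr (.inl ⟨h1, ⟨h2, h3⟩, h4⟩))))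
    · exact .inl (.inl (.inl (.inr (.inr (.inl ⟨h1, ⟨h2, h3⟩, h4⟩)))))
    · exact .inl (.inl (.inl (.inr (.inr (.inr (.inl ⟨h1, ⟨h2, h3⟩, h4⟩))))))
    · exact .inl (.inl (.inl (.inr (.inr (.inr (.inr ⟨h1, ⟨h2, h3⟩, h4⟩))))))
    · exact .inl (.inl (.inr ⟨g, hg, h1.symm, ⟨rfl, h3.symm⟩, h4.symm⟩))
    · exact .inl (.inr ⟨g, hg, h1.symm, ⟨rfl, h3.symm⟩, h4.symm⟩)
    · exact .inr h

theorem mem_errAut_F {S H : List GuardC} {R : List Rule} {M q : ℕ} :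
    q ∈ (errAut S H R M).F ↔ q = 0 ∨ q = 2 ∨ ∃ i < R.length, 4 + i = q := by
  simp [errAut]

theorem getD_storeOf {M : ℕ} {ℓ : List ℕ} (hℓ : ℓ.length = 8) {r : ℕ} (hr : r < 8 + M) :
    (storeOf M ℓ).getD r 0 = val ℓ r := by
  unfold storeOf val
  split_ifs with h
  · rw [List.getD_append _ _ _ _ (by omega)]
  · rw [List.getD_append_right _ _ _ _ (by omega), hℓ]
    simp [List.getD, show r - 8 < M by omega]

theorem val_replicate : val (List.replicate 8 0) = val [] := by
  funext r
  unfold val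
  split_ifs with h
  · interval_cases r <;> rfl
  · rfl

theorem sat_storeOf {M : ℕ} {ℓ ℓ' : List ℕ} {g : GuardC} (hℓ : ℓ.length = 8)
    (hg : GuardOK M g) : GuardC.Sat (storeOf M ℓ) ℓ' g ↔ GSat (val ℓ) ℓ' g := by
  unfold GuardC.Sat GSat
  refine forall₂_congr fun p hp => ?_
  rw [getD_storeOf hℓ (hg p hp).1]

theorem run_storeAct {M : ℕ} {s ℓ : List ℕ} (hs : s.length = 8) (hℓ : ℓ.length = 8) :
    ActionC.run ℓ storeAct (storeOf M s) = storeOf M ℓ := by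
  obtain ⟨a0, a1, a2, a3, a4, a5, a6, a7, rfl⟩ : ∃ a0 a1 a2 a3 a4 a5 a6 a7,
      ℓ = [a0, a1, a2, a3, a4, a5, a6, a7] := by
    match ℓ, hℓ with
    | [a0, a1, a2, a3, a4, a5, a6, a7], _ => exact ⟨_, _, _, _, _, _, _, _, rfl⟩
  obtain ⟨b0, b1, b2, b3, b4, b5, b6, b7, rfl⟩ : ∃ a0 a1 a2 a3 a4 a5 a6 a7,
      s = [a0, a1, a2, a3, a4, a5, a6, a7] := by
    match s, hs with
    | [a0, a1, a2, a3, a4, a5, a6, a7], _ => exact ⟨_, _, _, _, _, _, _, _, rfl⟩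
  rfl

section Automaton

variable {S H : List GuardC} {R : List Rule} {M : ℕ}

theorem acc_two (s : List ℕ) (w : List (List ℕ)) : (errAut S H R M).Acc 2 s w := by
  induction w generalizing s with
  | nil => exact ToplC.acc_nil.2 (mem_errAut_F.2 (.inr (.inl rfl)))
  | cons ℓ t ih =>
    refine ToplC.acc_cons.2 ⟨[], [], 2, mem_errDelta.2 (.inr (.inr (.inl ⟨rfl, rfl, rfl, rfl⟩))),
      by simp [GuardC.Sat], ih _⟩

theorem acc_rule (hR : ∀ r ∈ R, RuleOK M r) {i : ℕ} {r : Rule} (hi : R[i]? = some r)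
    {ℓ : List ℕ} (hℓ : ℓ.length = 8) (w : List (List ℕ)) :
    (errAut S H R M).Acc (4 + i) (storeOf M ℓ) w ↔ ∀ ℓ' ∈ w, ¬ Matches ℓ ℓ' r.2.2 := by
  have hr : r ∈ R := List.mem_of_getElem? hi
  have hl : i < R.length := by
    by_contra hc
    rw [List.getElem?_eq_none (by omega)] at hi
    cases hi
  induction w with
  | nil => simpa using ToplC.acc_nil.2 (mem_errAut_F.2 (.inr (.inr ⟨i, hl, rfl⟩)))
  | cons ℓ' t ih =>
    rw [List.forall_mem_cons, ToplC.acc_cons]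
    have hsat : ∀ p ∈ r.2.2, (GuardC.Sat (storeOf M ℓ) ℓ' [(false, p)] ↔
        val ℓ p.1 ≠ ℓ'.getD p.2 0) := fun p hp => by
      simp only [GuardC.Sat, List.mem_singleton, forall_eq]
      rw [getD_storeOf hℓ ((hR r hr).2.2 p hp).1]
      simp
    constructor
    · rintro ⟨g, a, q', hd, hg, hacc⟩
      rcases mem_errDelta.1 hd with h | h | h | h | h | h | h | ⟨j, r', hj, h | h⟩
      iterate 7 exact absurd h.1 (by omega)
      · have := (hR r' (List.mem_of_getElem? hj)).1
        exact absurd h.1 (by omega)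
      · obtain ⟨h1, rfl, rfl, p, hp, rfl⟩ := h
        obtain rfl : i = j := by omega
        obtain rfl : r = r' := by rw [hi] at hj; exact Option.some.inj hj
        exact ⟨fun hm => (hsat p hp).1 hg (hm p hp), ih.1 hacc⟩
    · rintro ⟨hm, hacc⟩
      unfold Matches at hm
      push Not at hm
      obtain ⟨p, hp, hne⟩ := hm
      exact ⟨[(false, p)], [], 4 + i, mem_errDelta.2 (.inr (.inr (.inr (.inr (.inr (.inr (.inr
        ⟨i, r, hi, .inr ⟨rfl, rfl, rfl, p, hp, rfl⟩⟩))))))), (hsat p hp).2 hne, ih.2 hacc⟩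

theorem acc_three (hR : ∀ r ∈ R, RuleOK M r) (hH : ∀ g ∈ H, GuardOK M g)
    {ℓ : List ℕ} (hℓ : ℓ.length = 8) (w : List (List ℕ)) :
    (errAut S H R M).Acc 3 (storeOf M ℓ) w ↔ ∃ ℓ' ∈ w, ∃ g ∈ H, GSat (val ℓ) ℓ' g := by
  induction w with
  | nil =>
    simp only [ToplC.acc_nil, mem_errAut_F, List.not_mem_nil, false_and, exists_false, iff_false]
    rintro (h | h | ⟨i, _, h⟩) <;> omega
  | cons ℓ' t ih =>
    rw [List.exists_mem_cons_iff, ← ih, ToplC.acc_cons]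
    constructor
    · rintro ⟨g, a, q', hd, hg, hacc⟩
      rcases mem_errDelta.1 hd with h | h | h | h | h | h | h | ⟨j, r', hj, h | h⟩
      iterate 4 exact absurd h.1 (by omega)
      · obtain ⟨-, rfl, rfl, rfl⟩ := h
        exact .inr hacc
      · exact absurd h.1 (by omega)
      · obtain ⟨-, hgH, rfl, rfl⟩ := h
        exact .inl ⟨g, hgH, (sat_storeOf hℓ (hH g hgH)).1 hg⟩
      · have := (hR r' (List.mem_of_getElem? hj)).1
        exact absurd h.1 (by omega)
      · exact absurd h.1 (by omega)
    · rintro (⟨g, hg, hs⟩ | hacc)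
      · exact ⟨g, [], 2, mem_errDelta.2 (.inr (.inr (.inr (.inr (.inr (.inr (.inl
          ⟨rfl, hg, rfl, rfl⟩))))))), (sat_storeOf hℓ (hH g hg)).2 hs, acc_two _ _⟩
      · exact ⟨[], [], 3, mem_errDelta.2 (.inr (.inr (.inr (.inr (.inl
          ⟨rfl, rfl, rfl, rfl⟩))))), by simp [GuardC.Sat], hacc⟩

theorem acc_one (hR : ∀ r ∈ R, RuleOK M r) (hS : ∀ g ∈ S, GuardOK M g)
    (hH : ∀ g ∈ H, GuardOK M g) (w : List (List ℕ)) (hw : ∀ ℓ ∈ w, ℓ.length = 8) :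
    (errAut S H R M).Acc 1 (storeOf M (List.replicate 8 0)) w ↔ ¬ Clean S H R w := by
  have h8 : (List.replicate 8 0).length = 8 := by simp
  induction w with
  | nil =>
    simp only [ToplC.acc_nil, mem_errAut_F, Clean, not_true, iff_false]
    rintro (h | h | ⟨i, _, h⟩) <;> omega
  | cons ℓ t ih =>
    rw [List.forall_mem_cons] at hw
    replace ih := ih hw.2
    rw [ToplC.acc_cons, Clean]
    constructor
    · rintro ⟨g, a, q', hd, hg, hacc⟩ ⟨c1, c2, c3, c4⟩
      rcases mem_errDelta.1 hd with h | h | h | h | h | h | h | ⟨j, r', hj, h | h⟩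
      · exact absurd h.1 (by omega)
      · obtain ⟨-, rfl, rfl, rfl⟩ := h
        exact ih.1 hacc c4
      · exact absurd h.1 (by omega)
      · obtain ⟨-, rfl, rfl, rfl⟩ := h
        rw [run_storeAct h8 hw.1, acc_three hR hH hw.1] at hacc
        obtain ⟨ℓ', hℓ', g, hg, hs⟩ := hacc
        exact c2 g hg ℓ' hℓ' hs
      · exact absurd h.1 (by omega)
      · obtain ⟨-, hgS, rfl, rfl⟩ := h
        rw [sat_storeOf h8 (hS g hgS), val_replicate] at hg
        exact c1 g hgS hg
      · exact absurd h.1 (by omega)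
      · obtain ⟨h1, rfl, rfl, rfl⟩ := h
        have hr := List.mem_of_getElem? hj
        rw [sat_storeOf h8 (hR r' hr).2.1, val_replicate] at hg
        rw [run_storeAct h8 hw.1, acc_rule hR hj hw.1] at hacc
        obtain ⟨ℓ', hℓ', hm⟩ := c3 r' hr h1.symm hg
        exact hacc ℓ' hℓ' hm
      · exact absurd h.1 (by omega)
    · intro hc
      by_cases c1 : ∃ g ∈ S, GSat (val []) ℓ g
      · obtain ⟨g, hg, hs⟩ := c1
        refine ⟨g, [], 2, mem_errDelta.2 (.inr (.inr (.inr (.inr (.inr (.inl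
          ⟨rfl, hg, rfl, rfl⟩)))))), ?_, acc_two _ _⟩
        rwa [sat_storeOf h8 (hS g hg), val_replicate]
      by_cases c2 : ∃ g ∈ H, ∃ ℓ' ∈ t, GSat (val ℓ) ℓ' g
      · obtain ⟨g, hg, ℓ', hℓ', hs⟩ := c2
        refine ⟨[], storeAct, 3, mem_errDelta.2 (.inr (.inr (.inr (.inl
          ⟨rfl, rfl, rfl, rfl⟩)))), by simp [GuardC.Sat], ?_⟩
        rw [run_storeAct h8 hw.1, acc_three hR hH hw.1]
        exact ⟨ℓ', hℓ', g, hg, hs⟩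
      by_cases c3 : ∃ r ∈ R, r.1 = 1 ∧ GSat (val []) ℓ r.2.1 ∧
          ∀ ℓ' ∈ t, ¬ Matches ℓ ℓ' r.2.2
      · obtain ⟨r, hr, h1, hs, hm⟩ := c3
        obtain ⟨i, hi⟩ := List.mem_iff_getElem?.1 hr
        refine ⟨r.2.1, storeAct, 4 + i, mem_errDelta.2 (.inr (.inr (.inr (.inr (.inr (.inr (.inr
          ⟨i, r, hi, .inl ⟨h1.symm, rfl, rfl, rfl⟩⟩))))))), ?_, ?_⟩
        · rwa [sat_storeOf h8 (hR r hr).2.1, val_replicate]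
        · rw [run_storeAct h8 hw.1, acc_rule hR hi hw.1]
          exact hm
      · refine ⟨[], [], 1, mem_errDelta.2 (.inr (.inl ⟨rfl, rfl, rfl, rfl⟩)),
          by simp [GuardC.Sat], ih.2 fun h4 => hc ⟨?_, ?_, ?_, h4⟩⟩
        · exact fun g hg hs => c1 ⟨g, hg, hs⟩
        · exact fun g hg ℓ' hℓ' hs => c2 ⟨g, hg, ℓ', hℓ', hs⟩
        · intro r hr h1 hs
          by_contra hn
          exact c3 ⟨r, hr, h1, hs, fun ℓ' hℓ' hm => hn ⟨ℓ', hℓ', hm⟩⟩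

theorem acc_zero (hR : ∀ r ∈ R, RuleOK M r) (hS : ∀ g ∈ S, GuardOK M g)
    (hH : ∀ g ∈ H, GuardOK M g) (w : List (List ℕ)) (hw : ∀ ℓ ∈ w, ℓ.length = 8) :
    (errAut S H R M).Acc 0 (storeOf M (List.replicate 8 0)) w ↔ ¬ Positive S H R w := by
  have h8 : (List.replicate 8 0).length = 8 := by simp
  cases w with
  | nil => simp [ToplC.acc_nil, mem_errAut_F, Positive]
  | cons ℓ t =>
    rw [List.forall_mem_cons] at hw
    have h1 := acc_one hR hS hH t hw.2
    rw [ToplC.acc_cons, Positive]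
    constructor
    · rintro ⟨g, a, q', hd, hg, hacc⟩ ⟨c3, c4⟩
      rcases mem_errDelta.1 hd with h | h | h | h | h | h | h | ⟨j, r', hj, h | h⟩
      · obtain ⟨-, rfl, rfl, rfl⟩ := h
        exact h1.1 hacc c4
      iterate 6 exact absurd h.1 (by omega)
      · obtain ⟨h1, rfl, rfl, rfl⟩ := h
        have hr := List.mem_of_getElem? hj
        rw [sat_storeOf h8 (hR r' hr).2.1, val_replicate] at hg
        rw [run_storeAct h8 hw.1, acc_rule hR hj hw.1] at hacc
        obtain ⟨ℓ', hℓ', hm⟩ := c3 r' hr h1.symm hg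
        exact hacc ℓ' hℓ' hm
      · exact absurd h.1 (by omega)
    · intro hc
      by_cases c3 : ∃ r ∈ R, r.1 = 0 ∧ GSat (val []) ℓ r.2.1 ∧
          ∀ ℓ' ∈ t, ¬ Matches ℓ ℓ' r.2.2
      · obtain ⟨r, hr, h1, hs, hm⟩ := c3
        obtain ⟨i, hi⟩ := List.mem_iff_getElem?.1 hr
        refine ⟨r.2.1, storeAct, 4 + i, mem_errDelta.2 (.inr (.inr (.inr (.inr (.inr (.inr (.inr
          ⟨i, r, hi, .inl ⟨h1.symm, rfl, rfl, rfl⟩⟩))))))), ?_, ?_⟩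
        · rwa [sat_storeOf h8 (hR r hr).2.1, val_replicate]
        · rw [run_storeAct h8 hw.1, acc_rule hR hi hw.1]
          exact hm
      · refine ⟨[], [], 1, mem_errDelta.2 (.inl ⟨rfl, rfl, rfl, rfl⟩),
          by simp [GuardC.Sat], h1.2 fun h4 => hc ⟨?_, h4⟩⟩
        intro r hr h1 hs
        by_contra hn
        exact c3 ⟨r, hr, h1, hs, fun ℓ' hℓ' hm => hn ⟨ℓ', hℓ', hm⟩⟩

theorem mem_lang_errAut (hR : ∀ r ∈ R, RuleOK M r) (hS : ∀ g ∈ S, GuardOK M g)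
    (hH : ∀ g ∈ H, GuardOK M g) (w : List (List ℕ)) :
    w ∈ (errAut S H R M).Lang ↔ (∀ ℓ ∈ w, ℓ.length = 8) ∧ ¬ Positive S H R w :=
  and_congr_right fun hw => acc_zero hR hS hH w hw

theorem errAut_wf (hR : ∀ r ∈ R, RuleOK M r) (hS : ∀ g ∈ S, GuardOK M g)
    (hH : ∀ g ∈ H, GuardOK M g) : (errAut S H R M).WF := by
  have hst : ∀ p ∈ storeAct, p.1 < 8 + M ∧ p.2 < 8 := by
    simp only [storeAct, List.mem_map, List.mem_range]
    rintro _ ⟨i, hi, rfl⟩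
    exact ⟨by simp only; omega, hi⟩
  refine ⟨by simp [errAut], by simp [errAut, storeOf]; omega, fun q hq => ?_, ?_⟩
  · change q < 4 + R.length
    rcases mem_errAut_F.1 hq with h | h | ⟨i, hi, h⟩ <;> omega
  · rintro ⟨q₁, ⟨g, a⟩, q₂⟩ ht
    change q₁ < 4 + R.length ∧ q₂ < 4 + R.length ∧ GuardOK M g ∧
      ∀ p ∈ a, p.1 < 8 + M ∧ p.2 < 8
    have hnil : GuardOK M [] := by simp [GuardOK]
    rcases mem_errDelta.1 ht with h | h | h | h | h | h | h | ⟨i, r, hi, h⟩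
    iterate 3
      obtain ⟨rfl, rfl, rfl, rfl⟩ := h
      exact ⟨by omega, by omega, hnil, by simp⟩
    · obtain ⟨rfl, rfl, rfl, rfl⟩ := h
      exact ⟨by omega, by omega, hnil, hst⟩
    · obtain ⟨rfl, rfl, rfl, rfl⟩ := h
      exact ⟨by omega, by omega, hnil, by simp⟩
    · obtain ⟨rfl, hg, rfl, rfl⟩ := h
      exact ⟨by omega, by omega, hS g hg, by simp⟩
    · obtain ⟨rfl, hg, rfl, rfl⟩ := h
      exact ⟨by omega, by omega, hH g hg, by simp⟩
    · have hr := hR r (List.mem_of_getElem? hi)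
      have hl : i < R.length := by
        by_contra hc
        rw [List.getElem?_eq_none (by omega)] at hi
        cases hi
      rcases h with ⟨rfl, rfl, rfl, rfl⟩ | ⟨rfl, rfl, rfl, p, hp, rfl⟩
      · exact ⟨by have := hr.1; omega, by omega, hr.2.1, hst⟩
      · refine ⟨by omega, by omega, ?_, by simp⟩
        simpa [GuardOK] using hr.2.2 p hp

end Automaton

/-- An automaton that accepts every word. -/
def fullAut : ToplC where
  m := 0
  n := 8
  k := 1
  q0 := 0
  s0 := []
  delta := [(0, ([], []), 0)]
  F := [0]

theorem fullAut_wf : fullAut.WF := by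
  simp [ToplC.WF, fullAut]

theorem mem_lang_fullAut (w : List (List ℕ)) :
    w ∈ fullAut.Lang ↔ ∀ ℓ ∈ w, ℓ.length = 8 := by
  refine and_iff_left ?_
  change fullAut.Acc 0 [] w
  induction w with
  | nil => exact ToplC.acc_nil.2 (by simp [fullAut])
  | cons ℓ t ih =>
    exact ToplC.acc_cons.2 ⟨[], [], 0, by simp [fullAut], by simp [GuardC.Sat], ih⟩

theorem errAut_spec {S H : List GuardC} {R : List Rule} {M : ℕ} (hR : ∀ r ∈ R, RuleOK M r)
    (hS : ∀ g ∈ S, GuardOK M g) (hH : ∀ g ∈ H, GuardOK M g) :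
    ((errAut S H R M).WF ∧ fullAut.WF ∧ (errAut S H R M).n = fullAut.n ∧
      (errAut S H R M).Lang = fullAut.Lang) ↔
    ¬ ∃ w, (∀ ℓ ∈ w, ℓ.length = 8) ∧ Positive S H R w := by
  constructor
  · rintro ⟨-, -, -, h⟩ ⟨w, hw, hp⟩
    have := (mem_lang_fullAut w).2 hw
    rw [← h, mem_lang_errAut hR hS hH] at this
    exact this.2 hp
  · refine fun h => ⟨errAut_wf hR hS hH, fullAut_wf, rfl, Set.ext fun w => ?_⟩
    rw [mem_lang_errAut hR hS hH, mem_lang_fullAut]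
    exact and_iff_left_of_imp fun hw hp => h ⟨w, hw, hp⟩

theorem primrec_ruleTrans : Primrec₂ ruleTrans := by
  have h1 : Primrec fun x : Rule × ℕ => x.1.1 := Primrec.fst.comp Primrec.fst
  have h2 : Primrec fun x : Rule × ℕ => x.1.2.1 := Primrec.fst.comp (Primrec.snd.comp Primrec.fst)
  have h3 : Primrec fun x : Rule × ℕ => x.1.2.2 := Primrec.snd.comp (Primrec.snd.comp Primrec.fst)
  have hq : Primrec fun x : Rule × ℕ => x.2 := Primrec.snd
  refine Primrec.list_cons.comp
    (h1.pair ((h2.pair (Primrec.const storeAct)).pair hq)) (Primrec.list_map h3 ?_)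
  have hq' : Primrec fun x : (Rule × ℕ) × (ℕ × ℕ) => x.1.2 := Primrec.snd.comp Primrec.fst
  exact hq'.pair (((Primrec.list_cons.comp ((Primrec.const false).pair Primrec.snd)
    (Primrec.const [])).pair (Primrec.const [])).pair hq')

theorem primrec_errDelta (S H : List GuardC) : Primrec (errDelta S H) := by
  refine Primrec.list_append.comp (Primrec.const _) (Primrec.list_flatMap
    (Primrec.list_range.comp Primrec.list_length) ?_)
  exact primrec_ruleTrans.comp
    ((Primrec.list_getD default).comp Primrec.fst Primrec.snd)
    (Primrec.nat_add.comp (Primrec.const 4) Primrec.snd)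

theorem primrec_errAut (S H : List GuardC) : Primrec₂ (errAut S H) := by
  have hlen : Primrec fun x : List Rule × ℕ => x.1.length := Primrec.list_length.comp Primrec.fst
  have hM : Primrec fun x : List Rule × ℕ => x.2 := Primrec.snd
  have hs : Primrec fun x : List Rule × ℕ => storeOf x.2 (List.replicate 8 0) :=
    Primrec.list_append.comp (Primrec.const _) (Primrec.list_range.comp hM)
  have hd : Primrec fun x : List Rule × ℕ => errDelta S H x.1 :=
    (primrec_errDelta S H).comp Primrec.fst
  have hF : Primrec fun x : List Rule × ℕ =>
      0 :: 2 :: (List.range x.1.length).map fun i => 4 + i :=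
    Primrec.list_cons.comp (Primrec.const 0) (Primrec.list_cons.comp (Primrec.const 2)
      (Primrec.list_map (Primrec.list_range.comp hlen)
        (Primrec.nat_add.comp (Primrec.const 4) Primrec.snd)))
  have h := (Primrec.nat_add.comp (Primrec.const 8) hM).pair ((Primrec.const 8).pair
    ((Primrec.nat_add.comp (Primrec.const 4) hlen).pair ((Primrec.const 0).pair
    (hs.pair (hd.pair hF)))))
  exact ((Primrec.of_equiv_symm (e := toplCEquiv)).comp h).of_eq fun _ => rfl

open Turing.ToPartrec (Code)

/-- An injective numbering of codes by numbers that are at least `3`. -/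
def enc : Code → ℕ
  | .zero' => Nat.pair 0 0 + 3
  | .succ => Nat.pair 1 0 + 3
  | .tail => Nat.pair 2 0 + 3
  | .cons f g => Nat.pair 3 (Nat.pair (enc f) (enc g)) + 3
  | .comp f g => Nat.pair 4 (Nat.pair (enc f) (enc g)) + 3
  | .case f g => Nat.pair 5 (Nat.pair (enc f) (enc g)) + 3
  | .fix f => Nat.pair 6 (enc f) + 3

theorem enc_injective : Function.Injective enc := by
  intro c
  induction c with
  | zero' => intro d h; cases d <;> simp [enc, Nat.pair_eq_pair] at h ⊢
  | succ => intro d h; cases d <;> simp [enc, Nat.pair_eq_pair] at h ⊢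
  | tail => intro d h; cases d <;> simp [enc, Nat.pair_eq_pair] at h ⊢
  | cons f g hf hg =>
    intro d h
    cases d <;> simp [enc, Nat.pair_eq_pair] at h ⊢
    exact ⟨hf h.1, hg h.2⟩
  | comp f g hf hg =>
    intro d h
    cases d <;> simp [enc, Nat.pair_eq_pair] at h ⊢
    exact ⟨hf h.1, hg h.2⟩
  | case f g hf hg =>
    intro d h
    cases d <;> simp [enc, Nat.pair_eq_pair] at h ⊢
    exact ⟨hf h.1, hg h.2⟩
  | fix f hf =>
    intro d h
    cases d <;> simp [enc, Nat.pair_eq_pair] at h ⊢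
    exact hf h

theorem three_le_enc (c : Code) : 3 ≤ enc c := by
  cases c <;> simp [enc]

/-- The pattern of a letter saying that `i` is the list with head `h` and tail `t`. -/
def consP (i h t : ℕ) : List (ℕ × ℕ) := [(8, 0), (i, 1), (h, 2), (t, 3)]

/-- The pattern of a letter saying that `a` is the successor of `b`. -/
def succP (a b : ℕ) : List (ℕ × ℕ) := [(9, 0), (a, 1), (b, 2)]

/-- The pattern of a letter saying that the possibly empty list `i` has head `h` and
tail `t`. -/
def headTailP (i h t : ℕ) : List (ℕ × ℕ) := [(10, 0), (i, 1), (h, 2), (t, 3)]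

/-- The pattern of a letter saying that `c` evaluates to `y` on input `x`. -/
def evalP (c : Code) (x y : ℕ) : List (ℕ × ℕ) := [(8 + enc c, 0), (x, 1), (y, 2)]

/-- The literal saying that a letter records an evaluation of `c`. -/
def tagG (c : Code) : Bool × ℕ × ℕ := (true, 8 + enc c, 0)

/-- The rule linking nonempty lists to their cells. -/
def headTailRule : Rule := (1, [(true, 10, 0), (false, 8, 1)], consP 1 2 3)

/-- The rules for letters that record an evaluation of `c`. The columns of such a letter are
the code, the input, the output, four auxiliary values and the choice of a branch. -/
def ownRules : Code → List Rule
  | .zero' => [(1, [tagG .zero'], consP 2 8 1)]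
  | .succ => [(1, [tagG .succ], headTailP 1 3 4), (1, [tagG .succ], succP 5 3),
      (1, [tagG .succ], consP 2 5 8)]
  | .tail => [(1, [tagG .tail], headTailP 1 3 2)]
  | .cons f g => [(1, [tagG (.cons f g)], evalP f 1 3), (1, [tagG (.cons f g)], headTailP 3 4 5),
      (1, [tagG (.cons f g)], evalP g 1 6), (1, [tagG (.cons f g)], consP 2 4 6)]
  | .comp f g => [(1, [tagG (.comp f g)], evalP g 1 3), (1, [tagG (.comp f g)], evalP f 3 2)]
  | .case f g => [(1, [tagG (.case f g), (true, 8, 7)], headTailP 1 8 3),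
      (1, [tagG (.case f g), (true, 8, 7)], evalP f 3 2),
      (1, [tagG (.case f g), (false, 8, 7)], headTailP 1 3 4),
      (1, [tagG (.case f g), (false, 8, 7)], succP 3 5),
      (1, [tagG (.case f g), (false, 8, 7)], consP 6 5 4),
      (1, [tagG (.case f g), (false, 8, 7)], evalP g 6 2)]
  | .fix f => [(1, [tagG (.fix f)], evalP f 1 3),
      (1, [tagG (.fix f), (true, 8, 7)], headTailP 3 8 2),
      (1, [tagG (.fix f), (false, 8, 7)], headTailP 3 4 5),
      (1, [tagG (.fix f), (false, 8, 7)], succP 4 6),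
      (1, [tagG (.fix f), (false, 8, 7)], evalP (.fix f) 5 2)]

/-- The rules for all subterms of a code. -/
def codeRules : Code → List Rule
  | .zero' => ownRules .zero'
  | .succ => ownRules .succ
  | .tail => ownRules .tail
  | .cons f g => ownRules (.cons f g) ++ (codeRules f ++ codeRules g)
  | .comp f g => ownRules (.comp f g) ++ (codeRules f ++ codeRules g)
  | .case f g => ownRules (.case f g) ++ (codeRules f ++ codeRules g)
  | .fix f => ownRules (.fix f) ++ codeRules f

/-- The guards for letters that are wrong on their own. -/
def singleErrs : List GuardC :=
  [[(true, 8, 0), (true, 8, 1)], [(true, 9, 0), (true, 8, 1)],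
    [(true, 10, 0), (true, 8, 1), (false, 8, 2)], [(true, 10, 0), (true, 8, 1), (false, 8, 3)]]

/-- The guards for letters contradicting an earlier letter. -/
def pairErrs : List GuardC :=
  [[(true, 8, 0), (true, 0, 0), (true, 1, 1), (false, 2, 2)],
    [(true, 8, 0), (true, 0, 0), (true, 1, 1), (false, 3, 3)],
    [(true, 9, 0), (true, 0, 0), (true, 1, 1), (false, 2, 2)]]

theorem gsat_nil {s : ℕ → ℕ} {ℓ : List ℕ} : GSat s ℓ [] := by simp [GSat]

theorem gsat_cons_true {s : ℕ → ℕ} {ℓ : List ℕ} {i j : ℕ} {g : GuardC} :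
    GSat s ℓ ((true, i, j) :: g) ↔ ℓ.getD j 0 = s i ∧ GSat s ℓ g := by
  simp only [GSat, List.forall_mem_cons, forall_true_left, reduceCtorEq, false_imp_iff, and_true]
  exact and_congr_left' eq_comm

theorem gsat_cons_false {s : ℕ → ℕ} {ℓ : List ℕ} {i j : ℕ} {g : GuardC} :
    GSat s ℓ ((false, i, j) :: g) ↔ ℓ.getD j 0 ≠ s i ∧ GSat s ℓ g := by
  simp only [GSat, List.forall_mem_cons, forall_true_left, reduceCtorEq, false_imp_iff, true_and]
  exact and_congr_left' ne_comm

theorem matches_nil {ℓ ℓ' : List ℕ} : Matches ℓ ℓ' [] := by simp [Matches]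

theorem matches_cons {ℓ ℓ' : List ℕ} {i j : ℕ} {P : List (ℕ × ℕ)} :
    Matches ℓ ℓ' ((i, j) :: P) ↔ ℓ'.getD j 0 = val ℓ i ∧ Matches ℓ ℓ' P := by
  simp only [Matches, List.forall_mem_cons]
  exact and_congr_left' eq_comm

theorem val_const (ℓ : List ℕ) (c : ℕ) : val ℓ (8 + c) = c := by simp [val]

theorem val_zero (ℓ : List ℕ) : val ℓ 8 = 0 := rfl

theorem val_one (ℓ : List ℕ) : val ℓ 9 = 1 := rfl

theorem val_two (ℓ : List ℕ) : val ℓ 10 = 2 := rfl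

theorem val_column (ℓ : List ℕ) {i : ℕ} (hi : i < 8) : val ℓ i = ℓ.getD i 0 := if_pos hi

/-- The word `w` has a letter starting with `k`, `a`, `b`, `c`. -/
def Has (w : List (List ℕ)) (k a b c : ℕ) : Prop :=
  ∃ ℓ ∈ w, ℓ.getD 0 0 = k ∧ ℓ.getD 1 0 = a ∧ ℓ.getD 2 0 = b ∧ ℓ.getD 3 0 = c

/-- The value `a` represents the number `n`. -/
def RepN (w : List (List ℕ)) : ℕ → ℕ → Prop
  | a, 0 => a = 0
  | a, n + 1 => ∃ b c, Has w 1 a b c ∧ RepN w b n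

/-- The value `a` represents the list `v`. -/
def RepL (w : List (List ℕ)) : ℕ → List ℕ → Prop
  | a, [] => a = 0
  | a, n :: v => ∃ h t, Has w 0 a h t ∧ RepN w h n ∧ RepL w t v

/-- The conditions on the letters of a word that make cells well-defined. -/
structure Consistent (w : List (List ℕ)) : Prop where
  cons_ne : ∀ h t, ¬ Has w 0 0 h t
  succ_ne : ∀ b c, ¬ Has w 1 0 b c
  nil : ∀ h t, Has w 2 0 h t → h = 0 ∧ t = 0
  cons_unique : ∀ a h t h' t', Has w 0 a h t → Has w 0 a h' t' → h = h' ∧ t = t'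
  succ_unique : ∀ a b c b' c', Has w 1 a b c → Has w 1 a b' c' → b = b'

theorem Clean.single {S H : List GuardC} {R : List Rule} {w : List (List ℕ)}
    (hw : Clean S H R w) : ∀ ℓ ∈ w, ∀ g ∈ S, ¬ GSat (val []) ℓ g := by
  induction w with
  | nil => simp
  | cons ℓ t ih =>
    rw [List.forall_mem_cons]
    exact ⟨hw.1, ih hw.2.2.2⟩

theorem Clean.rule {S H : List GuardC} {R : List Rule} {w : List (List ℕ)}
    (hw : Clean S H R w) : ∀ r ∈ R, r.1 = 1 → ∀ ℓ ∈ w, GSat (val []) ℓ r.2.1 →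
      ∃ ℓ' ∈ w, Matches ℓ ℓ' r.2.2 := by
  induction w with
  | nil => simp
  | cons ℓ t ih =>
    intro r hr h1 ℓ' hℓ' hs
    rcases List.mem_cons.1 hℓ' with rfl | hℓ'
    · obtain ⟨ℓ'', h, hm⟩ := hw.2.2.1 r hr h1 hs
      exact ⟨ℓ'', List.mem_cons_of_mem _ h, hm⟩
    · obtain ⟨ℓ'', h, hm⟩ := ih hw.2.2.2 r hr h1 ℓ' hℓ' hs
      exact ⟨ℓ'', List.mem_cons_of_mem _ h, hm⟩

theorem Clean.of_suffix {S H : List GuardC} {R : List Rule} {w t : List (List ℕ)}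
    (hw : Clean S H R w) (ht : t <:+ w) : Clean S H R t := by
  obtain ⟨s, rfl⟩ := ht
  induction s with
  | nil => exact hw
  | cons ℓ s ih => exact ih hw.2.2.2

theorem Clean.pair {S H : List GuardC} {R : List Rule} {w : List (List ℕ)}
    (hw : Clean S H R w) : ∀ ℓ ∈ w, ∀ ℓ' ∈ w, ℓ = ℓ' ∨ (∀ g ∈ H, ¬ GSat (val ℓ) ℓ' g) ∨
      ∀ g ∈ H, ¬ GSat (val ℓ') ℓ g := by
  induction w with
  | nil => simp
  | cons ℓ t ih =>
    intro a ha b hb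
    rcases List.mem_cons.1 ha with rfl | ha'
    · rcases List.mem_cons.1 hb with rfl | hb'
      · exact .inl rfl
      · exact .inr (.inl fun g hg => hw.2.1 g hg b hb')
    · rcases List.mem_cons.1 hb with rfl | hb'
      · exact .inr (.inr fun g hg => hw.2.1 g hg a ha')
      · exact ih hw.2.2.2 a ha' b hb'

theorem forall_singleErrs {ℓ : List ℕ} : (∀ g ∈ singleErrs, ¬ GSat (val []) ℓ g) ↔
    (ℓ.getD 0 0 = 0 → ℓ.getD 1 0 ≠ 0) ∧ (ℓ.getD 0 0 = 1 → ℓ.getD 1 0 ≠ 0) ∧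
    (ℓ.getD 0 0 = 2 → ℓ.getD 1 0 = 0 → ℓ.getD 2 0 = 0 ∧ ℓ.getD 3 0 = 0) := by
  simp only [singleErrs, List.forall_mem_cons, gsat_cons_true, gsat_cons_false, gsat_nil,
    val_zero, val_one, val_two, List.not_mem_nil, false_imp_iff, implies_true]
  tauto

theorem forall_pairErrs {ℓ ℓ' : List ℕ} : (∀ g ∈ pairErrs, ¬ GSat (val ℓ) ℓ' g) ↔
    (ℓ'.getD 0 0 = ℓ.getD 0 0 → ℓ'.getD 1 0 = ℓ.getD 1 0 →
      (ℓ'.getD 0 0 = 0 → ℓ'.getD 2 0 = ℓ.getD 2 0 ∧ ℓ'.getD 3 0 = ℓ.getD 3 0) ∧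
      (ℓ'.getD 0 0 = 1 → ℓ'.getD 2 0 = ℓ.getD 2 0)) := by
  have h (i : ℕ) (hi : i < 4) : val ℓ i = ℓ.getD i 0 := val_column ℓ (by omega)
  simp only [pairErrs, List.forall_mem_cons, gsat_cons_true, gsat_cons_false, gsat_nil,
    val_zero, val_one, List.not_mem_nil, false_imp_iff, implies_true, h 0 (by omega),
    h 1 (by omega), h 2 (by omega), h 3 (by omega)]
  tauto

theorem Clean.consistent {R : List Rule} {w : List (List ℕ)}
    (hw : Clean singleErrs pairErrs R w) : Consistent w := by
  have h1 := fun ℓ hℓ => forall_singleErrs.1 (hw.single ℓ hℓ)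
  have h2 : ∀ ℓ ∈ w, ∀ ℓ' ∈ w, ℓ'.getD 0 0 = ℓ.getD 0 0 → ℓ'.getD 1 0 = ℓ.getD 1 0 →
      (ℓ'.getD 0 0 = 0 → ℓ'.getD 2 0 = ℓ.getD 2 0 ∧ ℓ'.getD 3 0 = ℓ.getD 3 0) ∧
      (ℓ'.getD 0 0 = 1 → ℓ'.getD 2 0 = ℓ.getD 2 0) := by
    intro ℓ hℓ ℓ' hℓ' e0 e1
    rcases hw.pair ℓ hℓ ℓ' hℓ' with rfl | h | h
    · exact ⟨fun _ => ⟨rfl, rfl⟩, fun _ => rfl⟩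
    · exact forall_pairErrs.1 h e0 e1
    · have := forall_pairErrs.1 h e0.symm e1.symm
      exact ⟨fun h0 => ⟨(this.1 (e0 ▸ h0)).1.symm, (this.1 (e0 ▸ h0)).2.symm⟩,
        fun h0 => (this.2 (e0 ▸ h0)).symm⟩
  constructor
  · rintro h t ⟨ℓ, hℓ, e0, e1, -, -⟩
    exact (h1 ℓ hℓ).1 e0 e1
  · rintro h t ⟨ℓ, hℓ, e0, e1, -, -⟩
    exact (h1 ℓ hℓ).2.1 e0 e1
  · rintro h t ⟨ℓ, hℓ, e0, e1, rfl, rfl⟩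
    exact (h1 ℓ hℓ).2.2 e0 e1
  · rintro a h t h' t' ⟨ℓ, hℓ, e0, e1, rfl, rfl⟩ ⟨ℓ', hℓ', e0', e1', rfl, rfl⟩
    exact (h2 ℓ' hℓ' ℓ hℓ (e0.trans e0'.symm) (e1.trans e1'.symm)).1 e0
  · rintro a h t h' t' ⟨ℓ, hℓ, e0, e1, rfl, rfl⟩ ⟨ℓ', hℓ', e0', e1', rfl, rfl⟩
    exact (h2 ℓ' hℓ' ℓ hℓ (e0.trans e0'.symm) (e1.trans e1'.symm)).2 e0

namespace Consistent

variable {w : List (List ℕ)}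

theorem repN_zero (hw : Consistent w) {n : ℕ} (h : RepN w 0 n) : n = 0 := by
  cases n with
  | zero => rfl
  | succ n =>
    obtain ⟨b, c, hb, -⟩ := h
    exact absurd hb (hw.succ_ne b c)

theorem repN_succ (hw : Consistent w) {a b c n : ℕ} (h : RepN w a n) (hb : Has w 1 a b c) :
    ∃ k, n = k + 1 ∧ RepN w b k := by
  cases n with
  | zero =>
    obtain rfl : a = 0 := h
    exact absurd hb (hw.succ_ne b c)
  | succ n =>
    obtain ⟨b', c', hb', hr⟩ := h
    obtain rfl := hw.succ_unique _ _ _ _ _ hb hb'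
    exact ⟨n, rfl, hr⟩

theorem repL_headTail (hw : Consistent w)
    (hr : ∀ a h t, a ≠ 0 → Has w 2 a h t → Has w 0 a h t) {a h t : ℕ} {v : List ℕ}
    (ha : RepL w a v) (hc : Has w 2 a h t) : RepN w h v.headI ∧ RepL w t v.tail := by
  cases v with
  | nil =>
    obtain rfl : a = 0 := ha
    exact hw.nil h t hc
  | cons n v =>
    obtain ⟨h', t', hc', hh, ht⟩ := ha
    have ha : a ≠ 0 := by
      rintro rfl
      exact hw.cons_ne _ _ hc'
    obtain ⟨rfl, rfl⟩ := hw.cons_unique _ _ _ _ _ (hr a h t ha hc) hc'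
    exact ⟨hh, ht⟩

end Consistent

theorem gsat_tag {c : Code} {ℓ : List ℕ} {g : GuardC} :
    GSat (val []) ℓ (tagG c :: g) ↔ ℓ.getD 0 0 = enc c ∧ GSat (val []) ℓ g := by
  rw [tagG, gsat_cons_true, val_const]

theorem gsat_eq {ℓ : List ℕ} : GSat (val []) ℓ [(true, 8, 7)] ↔ ℓ.getD 7 0 = 0 := by
  rw [gsat_cons_true, val_zero, and_iff_left gsat_nil]

theorem gsat_ne {ℓ : List ℕ} : GSat (val []) ℓ [(false, 8, 7)] ↔ ℓ.getD 7 0 ≠ 0 := by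
  rw [gsat_cons_false, val_zero, and_iff_left gsat_nil]

theorem gsat_headTailRule {ℓ : List ℕ} : GSat (val []) ℓ headTailRule.2.1 ↔
    ℓ.getD 0 0 = 2 ∧ ℓ.getD 1 0 ≠ 0 := by
  rw [headTailRule, gsat_cons_true, gsat_cons_false, val_zero, val_two, and_iff_left gsat_nil]

theorem matches_consP {ℓ ℓ' : List ℕ} {i h t : ℕ} : Matches ℓ ℓ' (consP i h t) ↔
    ℓ'.getD 0 0 = 0 ∧ ℓ'.getD 1 0 = val ℓ i ∧ ℓ'.getD 2 0 = val ℓ h ∧ ℓ'.getD 3 0 = val ℓ t := by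
  simp only [consP, matches_cons, val_zero, matches_nil, and_true]

theorem matches_headTailP {ℓ ℓ' : List ℕ} {i h t : ℕ} : Matches ℓ ℓ' (headTailP i h t) ↔
    ℓ'.getD 0 0 = 2 ∧ ℓ'.getD 1 0 = val ℓ i ∧ ℓ'.getD 2 0 = val ℓ h ∧ ℓ'.getD 3 0 = val ℓ t := by
  simp only [headTailP, matches_cons, val_two, matches_nil, and_true]

theorem matches_succP {ℓ ℓ' : List ℕ} {a b : ℕ} : Matches ℓ ℓ' (succP a b) ↔
    ℓ'.getD 0 0 = 1 ∧ ℓ'.getD 1 0 = val ℓ a ∧ ℓ'.getD 2 0 = val ℓ b := by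
  simp only [succP, matches_cons, val_one, matches_nil, and_true]

theorem matches_evalP {ℓ ℓ' : List ℕ} {c : Code} {x y : ℕ} : Matches ℓ ℓ' (evalP c x y) ↔
    ℓ'.getD 0 0 = enc c ∧ ℓ'.getD 1 0 = val ℓ x ∧ ℓ'.getD 2 0 = val ℓ y := by
  simp only [evalP, matches_cons, val_const, matches_nil, and_true]

theorem exists_matches_consP {w : List (List ℕ)} {ℓ : List ℕ} {i h t : ℕ} :
    (∃ ℓ' ∈ w, Matches ℓ ℓ' (consP i h t)) ↔ Has w 0 (val ℓ i) (val ℓ h) (val ℓ t) := by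
  simp only [matches_consP, Has]

theorem exists_matches_headTailP {w : List (List ℕ)} {ℓ : List ℕ} {i h t : ℕ} :
    (∃ ℓ' ∈ w, Matches ℓ ℓ' (headTailP i h t)) ↔ Has w 2 (val ℓ i) (val ℓ h) (val ℓ t) := by
  simp only [matches_headTailP, Has]

theorem exists_matches_succP {w : List (List ℕ)} {ℓ : List ℕ} {a b : ℕ} :
    (∃ ℓ' ∈ w, Matches ℓ ℓ' (succP a b)) ↔ ∃ c, Has w 1 (val ℓ a) (val ℓ b) c := by
  simp only [matches_succP, Has]
  constructor
  · rintro ⟨ℓ', h, h0, h1, h2⟩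
    exact ⟨_, ℓ', h, h0, h1, h2, rfl⟩
  · rintro ⟨c, ℓ', h, h0, h1, h2, -⟩
    exact ⟨ℓ', h, h0, h1, h2⟩

/-- In the word `w`, all letters recording an evaluation of `c` are right. -/
def EvalSound (w : List (List ℕ)) (c : Code) : Prop :=
  ∀ ℓ ∈ w, ℓ.getD 0 0 = enc c → ∀ v, RepL w (ℓ.getD 1 0) v →
    ∃ u ∈ c.eval v, RepL w (ℓ.getD 2 0) u

theorem EvalSound.apply {w : List (List ℕ)} {c : Code} (h : EvalSound w c) {ℓ : List ℕ}
    {x y : ℕ} (he : ∃ ℓ' ∈ w, Matches ℓ ℓ' (evalP c x y)) {v : List ℕ}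
    (hv : RepL w (val ℓ x) v) : ∃ u ∈ c.eval v, RepL w (val ℓ y) u := by
  obtain ⟨ℓ', hℓ', hm⟩ := he
  obtain ⟨h0, h1, h2⟩ := matches_evalP.1 hm
  rw [← h1] at hv
  rw [← h2]
  exact h ℓ' hℓ' h0 v hv

section Soundness

variable {R : List Rule} {w : List (List ℕ)}

theorem evalSound (hw : Clean singleErrs pairErrs R w) (hht : headTailRule ∈ R) (c : Code)
    (hR : codeRules c ⊆ R) : EvalSound w c := by
  have hc := hw.consistent
  have hh : ∀ a h t, a ≠ 0 → Has w 2 a h t → Has w 0 a h t := by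
    rintro _ _ _ ha ⟨ℓ, hℓ, h0, rfl, rfl, rfl⟩
    exact exists_matches_consP.1 (hw.rule _ hht rfl ℓ hℓ (gsat_headTailRule.2 ⟨h0, ha⟩))
  have rule : ∀ {c : Code} {g : GuardC} {P : List (ℕ × ℕ)}, (1, tagG c :: g, P) ∈ R →
      ∀ {ℓ}, ℓ ∈ w → ℓ.getD 0 0 = enc c → GSat (val []) ℓ g → ∃ ℓ' ∈ w, Matches ℓ ℓ' P :=
    fun hr ℓ hℓ h0 hg => hw.rule _ hr rfl ℓ hℓ (gsat_tag.2 ⟨h0, hg⟩)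
  induction c with
  | zero' =>
    intro ℓ hℓ h0 v hv
    simp only [codeRules, ownRules, List.cons_subset] at hR
    have h1 := exists_matches_consP.1 (rule hR.1 hℓ h0 gsat_nil)
    exact ⟨0 :: v, by simp, _, _, h1, rfl, hv⟩
  | succ =>
    intro ℓ hℓ h0 v hv
    simp only [codeRules, ownRules, List.cons_subset] at hR
    have h1 := exists_matches_headTailP.1 (rule hR.1 hℓ h0 gsat_nil)
    obtain ⟨c, h2⟩ := exists_matches_succP.1 (rule hR.2.1 hℓ h0 gsat_nil)
    have h3 := exists_matches_consP.1 (rule hR.2.2.1 hℓ h0 gsat_nil)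
    obtain ⟨hn, -⟩ := hc.repL_headTail hh hv h1
    exact ⟨[v.headI.succ], by simp, _, _, h3, ⟨_, _, h2, hn⟩, rfl⟩
  | tail =>
    intro ℓ hℓ h0 v hv
    simp only [codeRules, ownRules, List.cons_subset] at hR
    have h1 := exists_matches_headTailP.1 (rule hR.1 hℓ h0 gsat_nil)
    exact ⟨v.tail, by simp, (hc.repL_headTail hh hv h1).2⟩
  | cons f g hf hg =>
    intro ℓ hℓ h0 v hv
    simp only [codeRules, ownRules, List.append_subset, List.cons_subset] at hR
    obtain ⟨⟨r1, r2, r3, r4, -⟩, hRf, hRg⟩ := hR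
    obtain ⟨u, hu, hru⟩ := (hf hRf).apply (rule r1 hℓ h0 gsat_nil) hv
    have h2 := exists_matches_headTailP.1 (rule r2 hℓ h0 gsat_nil)
    obtain ⟨u', hu', hru'⟩ := (hg hRg).apply (rule r3 hℓ h0 gsat_nil) hv
    have h4 := exists_matches_consP.1 (rule r4 hℓ h0 gsat_nil)
    refine ⟨u.headI :: u', ?_, _, _, h4, (hc.repL_headTail hh hru h2).1, hru'⟩
    rw [Code.cons_eval]
    exact Part.mem_bind hu (Part.mem_bind hu' (Part.mem_some _))
  | comp f g hf hg =>
    intro ℓ hℓ h0 v hv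
    simp only [codeRules, ownRules, List.append_subset, List.cons_subset] at hR
    obtain ⟨⟨r1, r2, -⟩, hRf, hRg⟩ := hR
    obtain ⟨u, hu, hru⟩ := (hg hRg).apply (rule r1 hℓ h0 gsat_nil) hv
    obtain ⟨u', hu', hru'⟩ := (hf hRf).apply (rule r2 hℓ h0 gsat_nil) hru
    refine ⟨u', ?_, hru'⟩
    rw [Code.comp_eval]
    exact Part.mem_bind hu hu'
  | case f g hf hg =>
    intro ℓ hℓ h0 v hv
    simp only [codeRules, ownRules, List.append_subset, List.cons_subset] at hR
    obtain ⟨⟨r1, r2, r3, r4, r5, r6, -⟩, hRf, hRg⟩ := hR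
    rw [Code.case_eval]
    by_cases h7 : ℓ.getD 7 0 = 0
    · have h1 := exists_matches_headTailP.1 (rule r1 hℓ h0 (gsat_eq.2 h7))
      obtain ⟨hn, ht⟩ := hc.repL_headTail hh hv h1
      obtain ⟨u, hu, hru⟩ := (hf hRf).apply (rule r2 hℓ h0 (gsat_eq.2 h7)) ht
      refine ⟨u, ?_, hru⟩
      simp only [hc.repN_zero hn]
      exact hu
    · have h1 := exists_matches_headTailP.1 (rule r3 hℓ h0 (gsat_ne.2 h7))
      obtain ⟨c, h2⟩ := exists_matches_succP.1 (rule r4 hℓ h0 (gsat_ne.2 h7))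
      have h3 := exists_matches_consP.1 (rule r5 hℓ h0 (gsat_ne.2 h7))
      obtain ⟨hn, ht⟩ := hc.repL_headTail hh hv h1
      obtain ⟨k, hk, hrk⟩ := hc.repN_succ hn h2
      obtain ⟨u, hu, hru⟩ := (hg hRg).apply (rule r6 hℓ h0 (gsat_ne.2 h7))
        (v := k :: v.tail) ⟨_, _, h3, hrk, ht⟩
      refine ⟨u, ?_, hru⟩
      simp only [hk]
      exact hu
  | fix f hf =>
    simp only [codeRules, List.append_subset] at hR
    have hfs := hf hR.2
    have hR := hR.1
    simp only [ownRules, List.cons_subset] at hR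
    obtain ⟨r1, r2, r3, r4, r5, -⟩ := hR
    suffices ∀ t, t <:+ w → ∀ ℓ ∈ t, ℓ.getD 0 0 = enc (.fix f) → ∀ v, RepL w (ℓ.getD 1 0) v →
        ∃ u ∈ (Code.fix f).eval v, RepL w (ℓ.getD 2 0) u from this w List.suffix_rfl
    intro t
    induction t with
    | nil => simp
    | cons ℓ₀ t ih =>
      intro ht ℓ hℓ h0 v hv
      have hts : t <:+ w := (List.suffix_cons ℓ₀ t).trans ht
      rcases List.mem_cons.1 hℓ with rfl | hℓ
      swap
      · exact ih hts ℓ hℓ h0 v hv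
      have hℓ : ℓ ∈ w := ht.subset List.mem_cons_self
      obtain ⟨u, hu, hru⟩ := hfs.apply (rule r1 hℓ h0 gsat_nil) hv
      simp only [Code.fix_eval]
      by_cases h7 : ℓ.getD 7 0 = 0
      · have h1 := exists_matches_headTailP.1 (rule r2 hℓ h0 (gsat_eq.2 h7))
        obtain ⟨hn, ht⟩ := hc.repL_headTail hh hru h1
        refine ⟨u.tail, PFun.mem_fix_iff.2 (.inl ?_), ht⟩
        exact (Part.mem_map_iff _).2 ⟨u, hu, if_pos (hc.repN_zero hn)⟩
      · have h1 := exists_matches_headTailP.1 (rule r3 hℓ h0 (gsat_ne.2 h7))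
        obtain ⟨c, h2⟩ := exists_matches_succP.1 (rule r4 hℓ h0 (gsat_ne.2 h7))
        obtain ⟨hn, htl⟩ := hc.repL_headTail hh hru h1
        obtain ⟨k, hk, hrk⟩ := hc.repN_succ hn h2
        obtain ⟨ℓ', hℓ', hm⟩ := (hw.of_suffix ht).2.2.1 _ r5 rfl (gsat_tag.2 ⟨h0, gsat_ne.2 h7⟩)
        obtain ⟨h0', h1', h2'⟩ := matches_evalP.1 hm
        rw [← h1'] at htl
        obtain ⟨y, hy, hry⟩ := ih hts ℓ' hℓ' h0' _ htl
        rw [h2'] at hry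
        refine ⟨y, PFun.mem_fix_iff.2 (.inr ⟨u.tail, ?_, ?_⟩), hry⟩
        · exact (Part.mem_map_iff _).2 ⟨u, hu, if_neg (by omega)⟩
        · simpa only [Code.fix_eval] using hy

end Soundness


/-- The letter satisfies the conditions for cells, under the canonical coding of lists. -/
structure LetterOK (ℓ : List ℕ) : Prop where
  length : ℓ.length = 8
  cons : ℓ.getD 0 0 = 0 → ℓ.getD 1 0 = Nat.pair (ℓ.getD 2 0) (ℓ.getD 3 0) + 1
  succ : ℓ.getD 0 0 = 1 → ℓ.getD 1 0 = ℓ.getD 2 0 + 1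
  nil : ℓ.getD 0 0 = 2 → ℓ.getD 1 0 = 0 → ℓ.getD 2 0 = 0 ∧ ℓ.getD 3 0 = 0

theorem LetterOK.single {ℓ : List ℕ} (h : LetterOK ℓ) :
    ∀ g ∈ singleErrs, ¬ GSat (val []) ℓ g := by
  refine forall_singleErrs.2 ⟨fun h0 => ?_, fun h1 => ?_, h.nil⟩
  · have := h.cons h0
    omega
  · have := h.succ h1
    omega

theorem LetterOK.pair {ℓ ℓ' : List ℕ} (h : LetterOK ℓ) (h' : LetterOK ℓ') :
    ∀ g ∈ pairErrs, ¬ GSat (val ℓ) ℓ' g := by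
  refine forall_pairErrs.2 fun e0 e1 => ⟨fun h0 => ?_, fun h1 => ?_⟩
  · rw [h'.cons h0, h.cons (e0 ▸ h0), Nat.add_right_cancel_iff, Nat.pair_eq_pair] at e1
    exact e1
  · have := h'.succ h1
    have := h.succ (e0 ▸ h1)
    omega

/-- A clean word of canonically coded letters. -/
def Good (R : List Rule) (w : List (List ℕ)) : Prop :=
  (∀ ℓ ∈ w, LetterOK ℓ) ∧ Clean singleErrs pairErrs R w

section Good

variable {R : List Rule}

theorem Good.append {w w' : List (List ℕ)} (hw : Good R w) (hw' : Good R w') :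
    Good R (w ++ w') := by
  refine ⟨fun ℓ hℓ => (List.mem_append.1 hℓ).elim (hw.1 ℓ) (hw'.1 ℓ), ?_⟩
  obtain ⟨hok, hc⟩ := hw
  induction w with
  | nil => exact hw'.2
  | cons ℓ t ih =>
    rw [List.forall_mem_cons] at hok
    refine ⟨hc.1, fun g hg ℓ' hℓ' => ?_, fun r hr h1 hs => ?_, ih hok.2 hc.2.2.2⟩
    · rcases List.mem_append.1 hℓ' with h | h
      · exact hc.2.1 g hg ℓ' h
      · exact hok.1.pair (hw'.1 ℓ' h) g hg
    · obtain ⟨ℓ', h, hm⟩ := hc.2.2.1 r hr h1 hs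
      exact ⟨ℓ', List.mem_append_left _ h, hm⟩

theorem exists_good {α : Type*} (F : α → List ℕ) (P : α → Prop) (l : List α)
    (h : ∀ a ∈ l, P a → ∃ w, F a ∈ w ∧ Good R w) :
    ∃ w, (∀ a ∈ l, P a → F a ∈ w) ∧ Good R w := by
  induction l with
  | nil => exact ⟨[], by simp, by simp, trivial⟩
  | cons a l ih =>
    rw [List.forall_mem_cons] at h
    obtain ⟨w, hw, hg⟩ := ih h.2
    by_cases ha : P a
    · obtain ⟨w', hw', hg'⟩ := h.1 ha
      refine ⟨w' ++ w, List.forall_mem_cons.2 ⟨fun _ => List.mem_append_left _ hw',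
        fun b hb hP => List.mem_append_right _ (hw b hb hP)⟩, hg'.append hg⟩
    · exact ⟨w, List.forall_mem_cons.2 ⟨fun h => absurd h ha, hw⟩, hg⟩

/-- The letter `ℓ` can be justified by finitely many applications of the rules in `R`. -/
inductive Deriv (R : List Rule) : List ℕ → Prop
  | mk (ℓ : List ℕ) (next : Rule → List ℕ) (hℓ : LetterOK ℓ)
      (hm : ∀ r ∈ R, r.1 = 1 ∧ GSat (val []) ℓ r.2.1 → Matches ℓ (next r) r.2.2)
      (hd : ∀ r ∈ R, r.1 = 1 ∧ GSat (val []) ℓ r.2.1 → Deriv R (next r)) : Deriv R ℓ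

theorem Deriv.intro {ℓ : List ℕ} (hℓ : LetterOK ℓ)
    (h : ∀ r ∈ R, r.1 = 1 ∧ GSat (val []) ℓ r.2.1 → ∃ ℓ', Deriv R ℓ' ∧ Matches ℓ ℓ' r.2.2) :
    Deriv R ℓ := by
  choose! f hf using h
  exact ⟨ℓ, f, hℓ, fun r hr hs => (hf r hr hs).2, fun r hr hs => (hf r hr hs).1⟩

theorem Deriv.exists_good {ℓ : List ℕ} (h : Deriv R ℓ) : ∃ w, ℓ ∈ w ∧ Good R w := by
  induction h with
  | mk ℓ next hℓ hm hd ih =>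
    obtain ⟨w, hw, hg⟩ := Topl.exists_good next _ R ih
    refine ⟨ℓ :: w, List.mem_cons_self, List.forall_mem_cons.2 ⟨hℓ, hg.1⟩, hℓ.single,
      fun g hg' ℓ' hℓ' => hℓ.pair (hg.1 ℓ' hℓ') g hg', fun r hr h1 hs => ?_, hg.2⟩
    exact ⟨next r, hw r hr ⟨h1, hs⟩, hm r hr ⟨h1, hs⟩⟩

theorem exists_positive (ℓ₀ : List ℕ) (hℓ₀ : ℓ₀.length = 8)
    (h : ∀ r ∈ R, r.1 = 0 → ∃ ℓ', Deriv R ℓ' ∧ Matches ℓ₀ ℓ' r.2.2) :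
    ∃ w, (∀ ℓ ∈ w, ℓ.length = 8) ∧ Positive singleErrs pairErrs R w := by
  choose! f hf using h
  obtain ⟨w, hw, hg⟩ := exists_good f _ R fun r hr h0 => (hf r hr h0).1.exists_good
  exact ⟨ℓ₀ :: w, List.forall_mem_cons.2 ⟨hℓ₀, fun ℓ hℓ => (hg.1 ℓ hℓ).length⟩,
    fun r hr h0 _ => ⟨f r, hw r hr h0, (hf r hr h0).2⟩, hg.2⟩

end Good

/-- The canonical identifier of a list. -/
def idL : List ℕ → ℕ
  | [] => 0
  | n :: v => Nat.pair n (idL v) + 1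

/-- All rules for letters other than the first belong to the standard ones. -/
def Standard (R : List Rule) : Prop :=
  ∀ r ∈ R, r.1 = 1 → r = headTailRule ∨ ∃ c, r ∈ ownRules c

theorem exists_eq_of_mem_ownRules {c : Code} {r : Rule} (hr : r ∈ ownRules c) :
    ∃ g P, r = (1, tagG c :: g, P) := by
  cases c <;> simp only [ownRules, List.mem_cons, List.not_mem_nil, or_false] at hr <;>
    rcases hr with rfl | hr <;> first | exact ⟨_, _, rfl⟩ | skip
  all_goals
    rcases hr with rfl | hr <;> first | exact ⟨_, _, rfl⟩ | skip
  all_goals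
    rcases hr with rfl | hr <;> first | exact ⟨_, _, rfl⟩ | skip
  all_goals
    rcases hr with rfl | hr <;> first | exact ⟨_, _, rfl⟩ | skip
  all_goals
    rcases hr with rfl | rfl <;> exact ⟨_, _, rfl⟩

section Completeness

variable {R : List Rule}

theorem Deriv.of_small (hR : Standard R) {ℓ : List ℕ} (hℓ : LetterOK ℓ) (h0 : ℓ.getD 0 0 < 3)
    (h2 : ℓ.getD 0 0 = 2 → ℓ.getD 1 0 ≠ 0 → ∃ ℓ', Deriv R ℓ' ∧ Matches ℓ ℓ' (consP 1 2 3)) :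
    Deriv R ℓ := by
  refine .intro hℓ fun r hr ⟨h1, hs⟩ => ?_
  rcases hR r hr h1 with rfl | ⟨c, hc⟩
  · obtain ⟨e0, e1⟩ := gsat_headTailRule.1 hs
    exact h2 e0 e1
  · obtain ⟨g, P, rfl⟩ := exists_eq_of_mem_ownRules hc
    have := (gsat_tag.1 hs).1
    have := three_le_enc c
    omega

theorem Deriv.of_eval (hR : Standard R) (c : Code) {ℓ : List ℕ} (hl : ℓ.length = 8)
    (h0 : ℓ.getD 0 0 = enc c)
    (h : ∀ r ∈ ownRules c, GSat (val []) ℓ r.2.1 → ∃ ℓ', Deriv R ℓ' ∧ Matches ℓ ℓ' r.2.2) :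
    Deriv R ℓ := by
  have := three_le_enc c
  refine .intro ⟨hl, by omega, by omega, by omega⟩ fun r hr ⟨h1, hs⟩ => ?_
  rcases hR r hr h1 with rfl | ⟨c', hc⟩
  · have := (gsat_headTailRule.1 hs).1
    omega
  · obtain ⟨g, P, rfl⟩ := exists_eq_of_mem_ownRules hc
    obtain rfl : c = c' := enc_injective (h0.symm.trans (gsat_tag.1 hs).1)
    exact h _ hc hs

theorem deriv_consP (hR : Standard R) {ℓ : List ℕ} {i h t : ℕ}
    (e : val ℓ i = Nat.pair (val ℓ h) (val ℓ t) + 1) :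
    ∃ ℓ', Deriv R ℓ' ∧ Matches ℓ ℓ' (consP i h t) := by
  refine ⟨[0, val ℓ i, val ℓ h, val ℓ t, 0, 0, 0, 0], .of_small hR ⟨rfl, fun _ => e, ?_, ?_⟩
    (by simp) (by simp), matches_consP.2 ⟨rfl, rfl, rfl, rfl⟩⟩ <;> simp

theorem deriv_succP (hR : Standard R) {ℓ : List ℕ} {a b : ℕ} (e : val ℓ a = val ℓ b + 1) :
    ∃ ℓ', Deriv R ℓ' ∧ Matches ℓ ℓ' (succP a b) := by
  refine ⟨[1, val ℓ a, val ℓ b, 0, 0, 0, 0, 0], .of_small hR ⟨rfl, ?_, fun _ => e, ?_⟩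
    (by simp) (by simp), matches_succP.2 ⟨rfl, rfl, rfl⟩⟩ <;> simp

theorem deriv_headTailP (hR : Standard R) {ℓ : List ℕ} {i h t : ℕ} {v : List ℕ}
    (hi : val ℓ i = idL v) (hh : val ℓ h = v.headI) (ht : val ℓ t = idL v.tail) :
    ∃ ℓ', Deriv R ℓ' ∧ Matches ℓ ℓ' (headTailP i h t) := by
  refine ⟨[2, val ℓ i, val ℓ h, val ℓ t, 0, 0, 0, 0], .of_small hR ⟨rfl, ?_, ?_, ?_⟩
    (by simp) ?_, matches_headTailP.2 ⟨rfl, rfl, rfl, rfl⟩⟩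
  · simp
  · simp
  · rintro - (h0 : val ℓ i = 0)
    cases v with
    | nil => exact ⟨hh, ht⟩
    | cons n v => rw [hi] at h0; cases h0
  · rintro - (h0 : val ℓ i ≠ 0)
    cases v with
    | nil => exact absurd hi h0
    | cons n v =>
      apply deriv_consP hR
      change val ℓ i = Nat.pair (val ℓ h) (val ℓ t) + 1
      rw [hi, hh, ht]
      rfl

/-- The evaluation of `c` on `v` to `u` can be justified. -/
def EvalDeriv (R : List Rule) (c : Code) (v u : List ℕ) : Prop :=
  ∃ ℓ, Deriv R ℓ ∧ ℓ.getD 0 0 = enc c ∧ ℓ.getD 1 0 = idL v ∧ ℓ.getD 2 0 = idL u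

theorem EvalDeriv.exists_matches {c : Code} {v u : List ℕ} (h : EvalDeriv R c v u) {ℓ : List ℕ}
    {x y : ℕ} (hx : val ℓ x = idL v) (hy : val ℓ y = idL u) :
    ∃ ℓ', Deriv R ℓ' ∧ Matches ℓ ℓ' (evalP c x y) := by
  obtain ⟨ℓ', hd, h0, h1, h2⟩ := h
  exact ⟨ℓ', hd, matches_evalP.2 ⟨h0, h1.trans hx.symm, h2.trans hy.symm⟩⟩

theorem EvalDeriv.intro (hR : Standard R) {c : Code} {v u : List ℕ} (a b d e f : ℕ)
    (h : ∀ r ∈ ownRules c, GSat (val []) [enc c, idL v, idL u, a, b, d, e, f] r.2.1 →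
      ∃ ℓ', Deriv R ℓ' ∧ Matches [enc c, idL v, idL u, a, b, d, e, f] ℓ' r.2.2) :
    EvalDeriv R c v u :=
  ⟨_, .of_eval hR c rfl rfl h, rfl, rfl, rfl⟩

theorem evalDeriv_fix_base (hR : Standard R) {f : Code} {v u : List ℕ} (h : EvalDeriv R f v u)
    (h0 : u.headI = 0) : EvalDeriv R (.fix f) v u.tail := by
  refine .intro hR (idL u) 0 0 0 0 ?_
  simp only [ownRules, List.forall_mem_cons, gsat_tag, gsat_eq, gsat_ne, List.not_mem_nil,
    false_imp_iff, implies_true, and_true]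
  exact ⟨fun _ => h.exists_matches rfl rfl, fun _ => deriv_headTailP hR rfl h0.symm rfl,
    fun hn => absurd rfl hn.2, fun hn => absurd rfl hn.2, fun hn => absurd rfl hn.2⟩

theorem evalDeriv_fix_step (hR : Standard R) {f : Code} {v u y : List ℕ}
    (h : EvalDeriv R f v u) (h0 : u.headI ≠ 0) (hy : EvalDeriv R (.fix f) u.tail y) :
    EvalDeriv R (.fix f) v y := by
  refine .intro hR (idL u) u.headI (idL u.tail) (u.headI - 1) 1 ?_
  simp only [ownRules, List.forall_mem_cons, gsat_tag, gsat_eq, gsat_ne, List.not_mem_nil,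
    false_imp_iff, implies_true, and_true]
  exact ⟨fun _ => h.exists_matches rfl rfl, fun hn => absurd hn.2 one_ne_zero,
    fun _ => deriv_headTailP hR rfl rfl rfl,
    fun _ => deriv_succP hR (Nat.succ_pred_eq_of_ne_zero h0).symm,
    fun _ => hy.exists_matches rfl rfl⟩

theorem evalDeriv (hR : Standard R) (c : Code) : ∀ v, ∀ u ∈ c.eval v, EvalDeriv R c v u := by
  induction c with
  | zero' =>
    intro v u hu
    rw [Code.zero'_eval] at hu
    obtain rfl := Part.mem_some_iff.1 hu
    refine .intro hR 0 0 0 0 0 ?_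
    simp only [ownRules, List.forall_mem_cons, List.not_mem_nil, false_imp_iff, implies_true,
      and_true]
    exact fun _ => deriv_consP hR rfl
  | succ =>
    intro v u hu
    rw [Code.succ_eval] at hu
    obtain rfl := Part.mem_some_iff.1 hu
    refine .intro hR v.headI (idL v.tail) v.headI.succ 0 0 ?_
    simp only [ownRules, List.forall_mem_cons, List.not_mem_nil, false_imp_iff, implies_true,
      and_true]
    exact ⟨fun _ => deriv_headTailP hR rfl rfl rfl, fun _ => deriv_succP hR rfl,
      fun _ => deriv_consP hR rfl⟩
  | tail =>
    intro v u hu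
    rw [Code.tail_eval] at hu
    obtain rfl := Part.mem_some_iff.1 hu
    refine .intro hR v.headI 0 0 0 0 ?_
    simp only [ownRules, List.forall_mem_cons, List.not_mem_nil, false_imp_iff, implies_true,
      and_true]
    exact fun _ => deriv_headTailP hR rfl rfl rfl
  | cons f g hf hg =>
    intro v u hu
    rw [Code.cons_eval] at hu
    obtain ⟨a, ha, hu⟩ := Part.mem_bind_iff.1 hu
    obtain ⟨b, hb, hu⟩ := Part.mem_bind_iff.1 hu
    obtain rfl := Part.mem_some_iff.1 hu
    refine .intro hR (idL a) a.headI (idL a.tail) (idL b) 0 ?_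
    simp only [ownRules, List.forall_mem_cons, List.not_mem_nil, false_imp_iff, implies_true,
      and_true]
    exact ⟨fun _ => (hf v a ha).exists_matches rfl rfl, fun _ => deriv_headTailP hR rfl rfl rfl,
      fun _ => (hg v b hb).exists_matches rfl rfl, fun _ => deriv_consP hR rfl⟩
  | comp f g hf hg =>
    intro v u hu
    rw [Code.comp_eval] at hu
    obtain ⟨a, ha, hu⟩ := Part.mem_bind_iff.1 hu
    refine .intro hR (idL a) 0 0 0 0 ?_
    simp only [ownRules, List.forall_mem_cons, List.not_mem_nil, false_imp_iff, implies_true,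
      and_true]
    exact ⟨fun _ => (hg v a ha).exists_matches rfl rfl,
      fun _ => (hf a u hu).exists_matches rfl rfl⟩
  | case f g hf hg =>
    intro v u hu
    rw [Code.case_eval] at hu
    rcases hn : v.headI with _ | k
    · simp only [hn] at hu
      refine .intro hR (idL v.tail) 0 0 0 0 ?_
      simp only [ownRules, List.forall_mem_cons, gsat_tag, gsat_eq, gsat_ne, List.not_mem_nil,
        false_imp_iff, implies_true, and_true]
      exact ⟨fun _ => deriv_headTailP hR rfl hn.symm rfl,
        fun _ => (hf _ u hu).exists_matches rfl rfl, fun h => absurd rfl h.2,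
        fun h => absurd rfl h.2, fun h => absurd rfl h.2, fun h => absurd rfl h.2⟩
    · simp only [hn] at hu
      refine .intro hR (k + 1) (idL v.tail) k (idL (k :: v.tail)) 1 ?_
      simp only [ownRules, List.forall_mem_cons, gsat_tag, gsat_eq, gsat_ne, List.not_mem_nil,
        false_imp_iff, implies_true, and_true]
      exact ⟨fun h => absurd h.2 one_ne_zero, fun h => absurd h.2 one_ne_zero,
        fun _ => deriv_headTailP hR rfl hn.symm rfl, fun _ => deriv_succP hR rfl,
        fun _ => deriv_consP hR rfl, fun _ => (hg _ u hu).exists_matches rfl rfl⟩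
  | fix f hf =>
    intro v u hu
    rw [Code.fix_eval] at hu
    refine PFun.fixInduction' (C := fun v => EvalDeriv R (.fix f) v u) hu ?_ ?_
    · intro a ha
      obtain ⟨b, hb, he⟩ := (Part.mem_map_iff _).1 ha
      split_ifs at he with h0
      cases he
      exact evalDeriv_fix_base hR (hf a b hb) h0
    · intro a a' _ ha' ih
      obtain ⟨b, hb, he⟩ := (Part.mem_map_iff _).1 ha'
      split_ifs at he with h0
      cases he
      exact evalDeriv_fix_step hR (hf a b hb) h0 ih

end Completeness

theorem enc_lt_left (k : ℕ) (f g : Code) : enc f < Nat.pair k (Nat.pair (enc f) (enc g)) + 3 := by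
  have := Nat.left_le_pair (enc f) (enc g)
  have := Nat.right_le_pair k (Nat.pair (enc f) (enc g))
  omega

theorem enc_lt_right (k : ℕ) (f g : Code) :
    enc g < Nat.pair k (Nat.pair (enc f) (enc g)) + 3 := by
  have := Nat.right_le_pair (enc f) (enc g)
  have := Nat.right_le_pair k (Nat.pair (enc f) (enc g))
  omega

theorem ruleOK_codeRules {M : ℕ} {c : Code} (hM : enc c < M) : ∀ r ∈ codeRules c, RuleOK M r := by
  have h3 := three_le_enc c
  induction c with
  | zero' =>
    simp only [codeRules, ownRules, RuleOK, GuardOK, tagG, consP,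
      List.forall_mem_cons, List.not_mem_nil, false_imp_iff, implies_true, and_true]
    omega
  | succ =>
    simp only [codeRules, ownRules, RuleOK, GuardOK, tagG, consP, headTailP, succP,
      List.forall_mem_cons, List.not_mem_nil, false_imp_iff, implies_true, and_true]
    omega
  | tail =>
    simp only [codeRules, ownRules, RuleOK, GuardOK, tagG, headTailP,
      List.forall_mem_cons, List.not_mem_nil, false_imp_iff, implies_true, and_true]
    omega
  | cons f g hf hg =>
    have h1 : enc f < enc (f.cons g) := enc_lt_left 3 f g
    have h2 : enc g < enc (f.cons g) := enc_lt_right 3 f g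
    simp only [codeRules, List.forall_mem_append]
    refine ⟨?_, hf (h1.trans hM) (three_le_enc f), hg (h2.trans hM) (three_le_enc g)⟩
    simp only [ownRules, RuleOK, GuardOK, tagG, consP, headTailP, evalP,
      List.forall_mem_cons, List.not_mem_nil, false_imp_iff, implies_true, and_true]
    omega
  | comp f g hf hg =>
    have h1 : enc f < enc (f.comp g) := enc_lt_left 4 f g
    have h2 : enc g < enc (f.comp g) := enc_lt_right 4 f g
    simp only [codeRules, List.forall_mem_append]
    refine ⟨?_, hf (h1.trans hM) (three_le_enc f), hg (h2.trans hM) (three_le_enc g)⟩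
    simp only [ownRules, RuleOK, GuardOK, tagG, evalP,
      List.forall_mem_cons, List.not_mem_nil, false_imp_iff, implies_true, and_true]
    omega
  | case f g hf hg =>
    have h1 : enc f < enc (f.case g) := enc_lt_left 5 f g
    have h2 : enc g < enc (f.case g) := enc_lt_right 5 f g
    simp only [codeRules, List.forall_mem_append]
    refine ⟨?_, hf (h1.trans hM) (three_le_enc f), hg (h2.trans hM) (three_le_enc g)⟩
    simp only [ownRules, RuleOK, GuardOK, tagG, consP, headTailP, succP, evalP,
      List.forall_mem_cons, List.not_mem_nil, false_imp_iff, implies_true, and_true]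
    omega
  | fix f hf =>
    have h1 : enc f < enc (.fix f) := by
      have := Nat.right_le_pair 6 (enc f)
      change enc f < Nat.pair 6 (enc f) + 3
      omega
    simp only [codeRules, List.forall_mem_append]
    refine ⟨?_, hf (h1.trans hM) (three_le_enc f)⟩
    simp only [ownRules, RuleOK, GuardOK, tagG, headTailP, succP, evalP,
      List.forall_mem_cons, List.not_mem_nil, false_imp_iff, implies_true, and_true]
    omega

theorem standard_codeRules (c : Code) : ∀ r ∈ codeRules c, ∃ c', r ∈ ownRules c' := by
  induction c with
  | zero' => exact fun r hr => ⟨_, hr⟩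
  | succ => exact fun r hr => ⟨_, hr⟩
  | tail => exact fun r hr => ⟨_, hr⟩
  | cons f g hf hg =>
    simp only [codeRules, List.forall_mem_append]
    exact ⟨fun r hr => ⟨_, hr⟩, hf, hg⟩
  | comp f g hf hg =>
    simp only [codeRules, List.forall_mem_append]
    exact ⟨fun r hr => ⟨_, hr⟩, hf, hg⟩
  | case f g hf hg =>
    simp only [codeRules, List.forall_mem_append]
    exact ⟨fun r hr => ⟨_, hr⟩, hf, hg⟩
  | fix f hf =>
    simp only [codeRules, List.forall_mem_append]
    exact ⟨fun r hr => ⟨_, hr⟩, hf⟩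

/-- The rules asking that `c` be evaluated on the list `[n]`, whose identifier is in the first
letter of the word, and that the numbers up to `n` have cells. -/
def inputRules (c : Code) (n : ℕ) : List Rule :=
  [(0, [], [(8 + enc c, 0), (1, 1)]), (0, [], consP 1 (8 + n) 8)] ++
    (List.range n).map fun i => (0, [], succP (8 + (i + 1)) (8 + i))

/-- The rules describing a terminating evaluation of `c` on `[n]`. -/
def haltRules (c : Code) (n : ℕ) : List Rule :=
  headTailRule :: codeRules c ++ inputRules c n

/-- The number of constants used in the rules for `c` and `n`. -/
def haltBound (c : Code) (n : ℕ) : ℕ := enc c + 1 + n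

theorem codeRules_src {c : Code} {r : Rule} (hr : r ∈ codeRules c) : r.1 = 1 := by
  obtain ⟨c', hc⟩ := standard_codeRules c r hr
  obtain ⟨g, P, rfl⟩ := exists_eq_of_mem_ownRules hc
  rfl

theorem inputRules_src {c : Code} {n : ℕ} {r : Rule} (hr : r ∈ inputRules c n) : r.1 = 0 := by
  simp only [inputRules, List.mem_append, List.mem_cons, List.not_mem_nil, or_false,
    List.mem_map] at hr
  rcases hr with (rfl | rfl) | ⟨i, -, rfl⟩ <;> rfl

theorem ruleOK_haltRules (c : Code) (n : ℕ) :
    ∀ r ∈ haltRules c n, RuleOK (haltBound c n) r := by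
  have h3 := three_le_enc c
  simp only [haltRules, List.forall_mem_append, List.forall_mem_cons, inputRules,
    List.forall_mem_map, List.mem_range]
  refine ⟨⟨?_, ruleOK_codeRules (by unfold haltBound; omega)⟩, ⟨?_, ?_, by simp⟩, fun i hi => ?_⟩
  all_goals
    simp [headTailRule, RuleOK, GuardOK, consP, succP, haltBound]
    try omega

theorem standard_haltRules (c : Code) (n : ℕ) : Standard (haltRules c n) := by
  intro r hr h1
  rcases List.mem_append.1 hr with hr | hr
  · rcases List.mem_cons.1 hr with rfl | hr
    · exact .inl rfl
    · exact .inr (standard_codeRules c r hr)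
  · have := inputRules_src hr
    omega

theorem dom_of_positive {c : Code} {n : ℕ} {w : List (List ℕ)}
    (hw : Positive singleErrs pairErrs (haltRules c n) w) : (c.eval [n]).Dom := by
  cases w with
  | nil => exact hw.elim
  | cons ℓ t =>
    obtain ⟨h0, ht⟩ := hw
    have h : ∀ r ∈ inputRules c n, ∃ ℓ' ∈ t, Matches ℓ ℓ' r.2.2 := by
      intro r hr
      refine h0 r (List.mem_append_right _ hr) (inputRules_src hr) ?_
      simp only [inputRules, List.mem_append, List.mem_cons, List.not_mem_nil, or_false,
        List.mem_map] at hr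
      rcases hr with (rfl | rfl) | ⟨i, -, rfl⟩ <;> exact gsat_nil
    simp only [inputRules, List.forall_mem_append, List.forall_mem_cons, List.forall_mem_map,
      List.mem_range, exists_matches_consP, exists_matches_succP, val_const, val_zero] at h
    obtain ⟨⟨⟨ℓ', hℓ', hm⟩, hc, -⟩, hs⟩ := h
    simp only [matches_cons, val_const] at hm
    have hn : ∀ i ≤ n, RepN t i i := by
      intro i
      induction i with
      | zero => exact fun _ => rfl
      | succ i ih =>
        intro hi
        obtain ⟨b, hb⟩ := hs i (by omega)
        exact ⟨i, b, hb, ih (by omega)⟩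
    have hsound := evalSound ht (by simp [haltRules]) c fun r hr => by simp [haltRules, hr]
    obtain ⟨u, hu, -⟩ := hsound ℓ' hℓ' hm.1 [n] ⟨_, _, by rw [hm.2.1]; exact hc, hn n le_rfl, rfl⟩
    exact Part.dom_iff_mem.2 ⟨u, hu⟩

theorem positive_of_dom {c : Code} {n : ℕ} (h : (c.eval [n]).Dom) :
    ∃ w, (∀ ℓ ∈ w, ℓ.length = 8) ∧ Positive singleErrs pairErrs (haltRules c n) w := by
  obtain ⟨u, hu⟩ := Part.dom_iff_mem.1 h
  have hR := standard_haltRules c n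
  refine exists_positive [0, idL [n], 0, 0, 0, 0, 0, 0] rfl fun r hr h0 => ?_
  rcases List.mem_append.1 hr with hr | hr
  · rcases List.mem_cons.1 hr with rfl | hr
    · cases h0
    · have := codeRules_src hr
      omega
  · simp only [inputRules, List.mem_append, List.mem_cons, List.not_mem_nil, or_false,
      List.mem_map] at hr
    rcases hr with (rfl | rfl) | ⟨i, -, rfl⟩
    · obtain ⟨ℓ', hd, e0, e1, -⟩ := evalDeriv hR c [n] u hu
      exact ⟨ℓ', hd, by simpa only [matches_cons, val_const, matches_nil, and_true] using ⟨e0, e1⟩⟩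
    · exact deriv_consP hR (by rw [val_const, val_zero]; rfl)
    · exact deriv_succP hR (by rw [val_const, val_const])

theorem haltRules_spec (c : Code) (n : ℕ) :
    ((errAut singleErrs pairErrs (haltRules c n) (haltBound c n)).WF ∧ fullAut.WF ∧
      (errAut singleErrs pairErrs (haltRules c n) (haltBound c n)).n = fullAut.n ∧
      (errAut singleErrs pairErrs (haltRules c n) (haltBound c n)).Lang = fullAut.Lang) ↔
    ¬ (c.eval [n]).Dom := by
  have h3 := three_le_enc c
  rw [errAut_spec (ruleOK_haltRules c n)]
  · exact not_congr ⟨fun ⟨w, _, hw⟩ => dom_of_positive hw, positive_of_dom⟩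
  · simp only [singleErrs, GuardOK, haltBound, List.forall_mem_cons, List.not_mem_nil,
      false_imp_iff, implies_true, and_true]
    omega
  · simp only [pairErrs, GuardOK, haltBound, List.forall_mem_cons, List.not_mem_nil,
      false_imp_iff, implies_true, and_true]
    omega

theorem primrec_haltRules (c : Code) : Primrec (haltRules c) := by
  have hadd (k : ℕ) : Primrec fun i : ℕ => k + i := Primrec.nat_add.comp (.const k) .id
  have hc (k : ℕ) : Primrec fun n : ℕ => (k, n) := Primrec.pair (.const k) .id
  have hp (f : ℕ → ℕ) (hf : Primrec f) (k : ℕ) : Primrec fun n : ℕ => (f n, k) :=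
    Primrec.pair hf (.const k)
  have hrule (f : ℕ → List (ℕ × ℕ)) (hf : Primrec f) :
      Primrec fun n : ℕ => ((0, [], f n) : Rule) :=
    Primrec.pair (.const 0) (Primrec.pair (.const []) hf)
  have hcons : Primrec fun n : ℕ => ((0, [], consP 1 (8 + n) 8) : Rule) :=
    hrule _ (Primrec.list_cons.comp (.const (8, 0)) (Primrec.list_cons.comp (.const (1, 1))
      (Primrec.list_cons.comp (hp _ (hadd 8) 2) (.const [(8, 3)]))))
  have hsucc : Primrec fun i : ℕ => ((0, [], succP (8 + (i + 1)) (8 + i)) : Rule) :=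
    hrule _ (Primrec.list_cons.comp (.const (9, 0)) (Primrec.list_cons.comp
      (hp _ ((hadd 8).comp .succ) 1) (Primrec.list_cons.comp (hp _ (hadd 8) 2) (.const []))))
  refine Primrec.list_append.comp (.const (headTailRule :: codeRules c))
    (Primrec.list_append.comp ?_ (Primrec.list_map .list_range (hsucc.comp₂ .right)))
  exact Primrec.list_cons.comp (.const (0, [], [(8 + enc c, 0), (1, 1)]))
    (Primrec.list_cons.comp hcons (.const []))

/-- Some code halts exactly on the solvable instances of the halting problem. -/
theorem exists_universal :
    ∃ c : Code, ∀ d : Nat.Partrec.Code, (c.eval [Encodable.encode d]).Dom ↔ (d.eval 0).Dom := by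
  have hf : Partrec fun n : ℕ => (Denumerable.ofNat Nat.Partrec.Code n).eval 0 :=
    Nat.Partrec.Code.eval_part.comp (Computable.ofNat _) (Computable.const 0)
  obtain ⟨c, hc⟩ := Code.exists_code (Nat.Partrec'.part_iff₁.2 hf)
  refine ⟨c, fun d => ?_⟩
  have := hc ⟨[Encodable.encode d], rfl⟩
  simp only at this
  rw [this]
  simp [List.Vector.head]

/-- The language equivalence problem for TOPL automata (over `V = ℕ`) is undecidable: the
set of (codes of) pairs of well-formed TOPL automata over the same alphabet `V^n` with
`L(A₁) = L(A₂)` is not a computable predicate. -/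
theorem topl_equivalence_undecidable :
    ¬ ComputablePred fun p : ToplC × ToplC =>
        p.1.WF ∧ p.2.WF ∧ p.1.n = p.2.n ∧ p.1.Lang = p.2.Lang := by
  intro h
  obtain ⟨c, hc⟩ := exists_universal
  have hM : Primrec (haltBound c) := Primrec.nat_add.comp (.const (enc c + 1)) .id
  have hA : Primrec fun n =>
      (errAut singleErrs pairErrs (haltRules c n) (haltBound c n), fullAut) :=
    Primrec.pair ((primrec_errAut singleErrs pairErrs).comp (primrec_haltRules c) hM)
      (.const fullAut)
  refine ComputablePred.halting_problem 0 ?_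
  have key : ComputablePred fun d : Nat.Partrec.Code => ¬ (d.eval 0).Dom :=
    ComputablePred.computable_of_manyOneReducible
      ⟨fun d => (errAut singleErrs pairErrs (haltRules c (Encodable.encode d))
        (haltBound c (Encodable.encode d)), fullAut), (hA.comp Primrec.encode).to_comp,
        fun d => (not_congr (hc d)).symm.trans (haltRules_spec c _).symm⟩ h
  simpa only [not_not] using key.not

end Topl
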